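/- arXiv:2006.07947 — 2 statements merged into one kernel-verified Lean document; each statement's English description precedes it below -/
import Mathlib

section
/- For every Coxeter group W with finite generating set S, the standard language 𝓛 ⊆ S* is a regular language. -/
namespace CoxeterPaper

open CoxeterSystem

attribute [local instance] Classical.propDecidable

variable {B : Type} [DecidableEq B] [Fintype B]
variable {W : Type} [Group W] {M : CoxeterMatrix B}

/-- The right descent set `T(g) = {s ∈ S : ℓ(gs) < ℓ(g)}`, as a set of indices. -/
def descentSet (cs : CoxeterSystem M W) (g : W) : Set B :=
  {i | cs.IsRightDescent g i}

/-- The subgroup `⟨T(g)⟩` generated by the right descent set of `g`. -/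
def descSubgroup (cs : CoxeterSystem M W) (g : W) : Subgroup W :=
  Subgroup.closure (cs.simple '' descentSet cs g)

/-- `w(g)`: the longest element of `⟨T(g)⟩` (defined via choice; for `g ≠ 1` the
subgroup `⟨T(g)⟩` is finite and has a unique longest element). -/
noncomputable def wg (cs : CoxeterSystem M W) (g : W) : W :=
  if h : ∃ w₀ ∈ descSubgroup cs g, ∀ u ∈ descSubgroup cs g, cs.length u ≤ cs.length w₀
  then h.choose else 1

/-- `Π(g) = g · w(g)`. -/
noncomputable def PiMap (cs : CoxeterSystem M W) (g : W) : W := g * wg cs g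

/-- The standard language `𝓛 ⊆ S*`: the empty word is in `𝓛` (and it is the only word of `𝓛`
representing the identity); a word `v` of length `n` representing `g ≠ 1` is in `𝓛` iff,
setting `k = ℓ(w(g))`, the prefix `v(n-k)` is in `𝓛` and `v(n-k+1, n)` represents `w(g)`. -/
inductive StdLang (cs : CoxeterSystem M W) : List B → Prop
  | nil : StdLang cs []
  | step (v : List B) (hne : cs.wordProd v ≠ 1)
      (hpre : StdLang cs (v.take (v.length - cs.length (wg cs (cs.wordProd v)))))
      (hsuf : cs.wordProd (v.drop (v.length - cs.length (wg cs (cs.wordProd v))))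
        = wg cs (cs.wordProd v)) : StdLang cs v

/-- A Coxeter group is 2-dimensional if every triple of distinct generators
generates an infinite subgroup. -/
def TwoDimensional (cs : CoxeterSystem M W) : Prop :=
  ∀ i j k : B, i ≠ j → i ≠ k → j ≠ k →
    Infinite (Subgroup.closure {cs.simple i, cs.simple j, cs.simple k} : Subgroup W)

/-- The wall of the reflection `ρ` separates `g` and `h`. -/
def Separates (cs : CoxeterSystem M W) (ρ g h : W) : Prop :=
  Xor' (cs.length (ρ * g) < cs.length g) (cs.length (ρ * h) < cs.length h)

/-- `h` is adjacent to the wall of the reflection `ρ`. -/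
def AdjacentWall (cs : CoxeterSystem M W) (ρ h : W) : Prop :=
  ∃ i : B, ρ = h * cs.simple i * h⁻¹

/-- The wall of `ρ'` separates `g` from the wall of `ρ`. -/
def SeparatesFromWall (cs : CoxeterSystem M W) (ρ' g ρ : W) : Prop :=
  ∀ h : W, AdjacentWall cs ρ h → Separates cs ρ' g h

/-- `𝓦(g)`: the set of walls (identified with their reflections) separating `g` from the
identity and not separated from `g` by any other wall. -/
def WallsNear (cs : CoxeterSystem M W) (g : W) : Set W :=
  {ρ | cs.IsReflection ρ ∧ cs.length (ρ * g) < cs.length g ∧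
    ∀ ρ' : W, cs.IsReflection ρ' → ρ' ≠ ρ → ¬ SeparatesFromWall cs ρ' g ρ}

/-! ### The geometric representation -/

/-- The canonical bilinear form of a Coxeter matrix; the value `-1` is used when `M i j = ∞`. -/
noncomputable def geoForm (M : CoxeterMatrix B) : LinearMap.BilinForm ℝ (B → ℝ) :=
  Matrix.toBilin' (Matrix.of fun i j => -Real.cos (Real.pi / M i j))

/-- The simple root indexed by `i`. -/
noncomputable def simpleRoot (i : B) : B → ℝ := Pi.single i 1

lemma geoForm_simpleRoot (M : CoxeterMatrix B) (i j : B) :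
    geoForm M (simpleRoot i) (simpleRoot j) = -Real.cos (Real.pi / M i j) := by
  simp [geoForm, simpleRoot, Matrix.toBilin'_single]

lemma geoForm_simpleRoot_self (M : CoxeterMatrix B) (i : B) :
    geoForm M (simpleRoot i) (simpleRoot i) = 1 := by
  simp [geoForm_simpleRoot]

lemma linearMap_eq_sum {F : Type*} [AddCommGroup F] [Module ℝ F] (f : (B → ℝ) →ₗ[ℝ] F)
    (x : B → ℝ) : f x = ∑ i, x i • f (simpleRoot i) := by
  rw [f.pi_apply_eq_sum_univ x]
  refine Finset.sum_congr rfl fun i _ => ?_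
  congr 2
  ext j
  simp [simpleRoot, Pi.single_apply, eq_comm]

lemma geoForm_comm (M : CoxeterMatrix B) (x y : B → ℝ) : geoForm M x y = geoForm M y x := by
  have h : (geoForm M).flip = geoForm M := by
    refine LinearMap.pi_ext' fun i => LinearMap.ext_ring ?_
    refine LinearMap.pi_ext' fun j => LinearMap.ext_ring ?_
    change geoForm M (simpleRoot j) (simpleRoot i) = geoForm M (simpleRoot i) (simpleRoot j)
    rw [geoForm_simpleRoot, geoForm_simpleRoot, M.symmetric]
  exact (LinearMap.congr_fun (LinearMap.congr_fun h y) x)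

lemma geoForm_simpleRoot_nonpos (M : CoxeterMatrix B) {i j : B} (h : i ≠ j) :
    geoForm M (simpleRoot i) (simpleRoot j) ≤ 0 := by
  rw [geoForm_simpleRoot, neg_nonpos]
  have h1 := M.off_diagonal i j h
  apply Real.cos_nonneg_of_neg_pi_div_two_le_of_le
  · have := Real.pi_pos
    have : 0 ≤ Real.pi / M i j := by positivity
    linarith
  · rcases Nat.eq_zero_or_pos (M i j) with h0 | h0
    · simpa [h0] using Real.pi_div_two_pos.le
    · have : (2 : ℝ) ≤ M i j := by exact_mod_cast (by omega : 2 ≤ M i j)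
      exact div_le_div_of_nonneg_left Real.pi_pos.le (by norm_num) this

/-- The reflection of the geometric representation in the simple root indexed by `i`. -/
noncomputable def simpleRefl (M : CoxeterMatrix B) (i : B) : Module.End ℝ (B → ℝ) :=
  LinearMap.id - (2 : ℝ) • (geoForm M (simpleRoot i)).smulRight (simpleRoot i)

lemma simpleRefl_apply (M : CoxeterMatrix B) (i : B) (x : B → ℝ) :
    simpleRefl M i x = x - (2 * geoForm M (simpleRoot i) x) • simpleRoot i := by
  simp [simpleRefl, mul_smul]

lemma simpleRefl_self (M : CoxeterMatrix B) (i : B) :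
    simpleRefl M i (simpleRoot i) = -simpleRoot i := by
  rw [simpleRefl_apply, geoForm_simpleRoot_self]
  module

lemma simpleRefl_simpleRefl (M : CoxeterMatrix B) (i : B) (x : B → ℝ) :
    simpleRefl M i (simpleRefl M i x) = x := by
  simp only [simpleRefl_apply, map_sub, map_smul, geoForm_simpleRoot_self]
  module

/-- The coefficients of roots in a rank two root system: `dihedralCoeff (cos θ) n` is
`sin (n θ) / sin θ`. -/
def dihedralCoeff (c : ℝ) : ℕ → ℝ
  | 0 => 0
  | 1 => 1
  | n + 2 => 2 * c * dihedralCoeff c (n + 1) - dihedralCoeff c n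

lemma dihedralCoeff_mul_sin (θ : ℝ) (n : ℕ) :
    dihedralCoeff (Real.cos θ) n * Real.sin θ = Real.sin (n * θ) := by
  induction n using Nat.twoStepInduction with
  | zero => simp [dihedralCoeff]
  | one => simp [dihedralCoeff]
  | more n h1 h2 =>
    rw [dihedralCoeff, sub_mul, mul_assoc, h2, h1]
    have e1 : ((n + 2 : ℕ) : ℝ) * θ = ((n + 1 : ℕ) : ℝ) * θ + θ := by push_cast; ring
    have e2 : (n : ℝ) * θ = ((n + 1 : ℕ) : ℝ) * θ - θ := by push_cast; ring
    rw [e1, e2, Real.sin_add, Real.sin_sub]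
    ring

lemma dihedralCoeff_one (n : ℕ) : dihedralCoeff 1 n = n := by
  induction n using Nat.twoStepInduction with
  | zero => simp [dihedralCoeff]
  | one => simp [dihedralCoeff]
  | more n h1 h2 => rw [dihedralCoeff, h1, h2]; push_cast; ring

lemma simpleRefl_combination (M : CoxeterMatrix B) (i j : B) (p q : ℝ) :
    simpleRefl M j (p • simpleRoot i + q • simpleRoot j) =
      p • simpleRoot i + (2 * Real.cos (Real.pi / M i j) * p - q) • simpleRoot j := by
  simp only [simpleRefl_apply, map_add, map_smul, geoForm_simpleRoot,
    M.diagonal, M.symmetric j i]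
  simp
  module

lemma sin_pi_div_pos {m : ℕ} (h : 2 ≤ m) : 0 < Real.sin (Real.pi / m) := by
  have h2 : (2 : ℝ) ≤ m := by exact_mod_cast h
  apply Real.sin_pos_of_pos_of_lt_pi
  · have := Real.pi_pos
    positivity
  · exact div_lt_self Real.pi_pos (by linarith)

lemma simpleRefl_mul_pow_apply (M : CoxeterMatrix B) (i j : B) (n : ℕ) :
    ((simpleRefl M i * simpleRefl M j) ^ n) (simpleRoot i) =
      dihedralCoeff (Real.cos (Real.pi / M i j)) (2 * n + 1) • simpleRoot i +
        dihedralCoeff (Real.cos (Real.pi / M i j)) (2 * n) • simpleRoot j := by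
  induction n with
  | zero => simp [dihedralCoeff]
  | succ n ih =>
    rw [pow_succ', Module.End.mul_apply, ih, Module.End.mul_apply, simpleRefl_combination,
      add_comm, simpleRefl_combination, M.symmetric j i, add_comm,
      show 2 * (n + 1) = 2 * n + 2 by ring, dihedralCoeff, dihedralCoeff]

lemma simpleRefl_mul_pow_fix (M : CoxeterMatrix B) {i j : B} (hij : i ≠ j) :
    ((simpleRefl M i * simpleRefl M j) ^ M i j) (simpleRoot i) = simpleRoot i := by
  rcases Nat.eq_zero_or_pos (M i j) with h0 | h0
  · simp [h0]
  have h1 := M.off_diagonal i j hij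
  have hs := sin_pi_div_pos (show 2 ≤ M i j by omega)
  have hm : (M i j : ℝ) ≠ 0 := by positivity
  have e0 : dihedralCoeff (Real.cos (Real.pi / M i j)) (2 * M i j) = 0 := by
    have := dihedralCoeff_mul_sin (Real.pi / M i j) (2 * M i j)
    rw [show ((2 * M i j : ℕ) : ℝ) * (Real.pi / M i j) = 2 * Real.pi by
      push_cast; field_simp, Real.sin_two_pi] at this
    exact (mul_eq_zero.1 this).resolve_right hs.ne'
  have e1 : dihedralCoeff (Real.cos (Real.pi / M i j)) (2 * M i j + 1) = 1 := by
    have := dihedralCoeff_mul_sin (Real.pi / M i j) (2 * M i j + 1)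
    rw [show ((2 * M i j + 1 : ℕ) : ℝ) * (Real.pi / M i j) = Real.pi / M i j + 2 * Real.pi by
      push_cast; field_simp; ring, Real.sin_add_two_pi] at this
    exact mul_right_cancel₀ hs.ne' (this.trans (one_mul _).symm)
  rw [simpleRefl_mul_pow_apply, e0, e1]
  simp

lemma simpleRefl_isLiftable (M : CoxeterMatrix B) : M.IsLiftable (simpleRefl M) := by
  intro i j
  have hinv (k : B) : simpleRefl M k * simpleRefl M k = 1 :=
    LinearMap.ext fun x => simpleRefl_simpleRefl M k x
  by_cases hij : i = j
  · subst hij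
    simp [hinv]
  rcases Nat.eq_zero_or_pos (M i j) with h0 | h0
  · simp [h0]
  have h1 := M.off_diagonal i j hij
  have hs := sin_pi_div_pos (show 2 ≤ M i j by omega)
  have hfi := simpleRefl_mul_pow_fix M hij
  have hfj : ((simpleRefl M i * simpleRefl M j) ^ M i j) (simpleRoot j) = simpleRoot j := by
    have h := simpleRefl_mul_pow_fix M (Ne.symm hij)
    have hc : (simpleRefl M i * simpleRefl M j) * (simpleRefl M j * simpleRefl M i) = 1 := by
      rw [mul_assoc, ← mul_assoc (simpleRefl M j), hinv, one_mul, hinv]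
    have hc' : (simpleRefl M j * simpleRefl M i) * (simpleRefl M i * simpleRefl M j) = 1 := by
      rw [mul_assoc, ← mul_assoc (simpleRefl M i), hinv, one_mul, hinv]
    have hcomm : Commute (simpleRefl M i * simpleRefl M j) (simpleRefl M j * simpleRefl M i) :=
      hc.trans hc'.symm
    rw [M.symmetric j i] at h
    conv_lhs => rw [← h]
    rw [← Module.End.mul_apply, ← hcomm.mul_pow, hc, one_pow, Module.End.one_apply]
  have horth (z : B → ℝ) (hi : geoForm M (simpleRoot i) z = 0)
      (hj : geoForm M (simpleRoot j) z = 0) (n : ℕ) :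
      ((simpleRefl M i * simpleRefl M j) ^ n) z = z := by
    induction n with
    | zero => simp
    | succ n ih =>
      rw [pow_succ, Module.End.mul_apply, Module.End.mul_apply, simpleRefl_apply M j, hj]
      simp [simpleRefl_apply, hi, ih]
  refine LinearMap.ext fun x => ?_
  set c := Real.cos (Real.pi / M i j)
  have hc : 1 - c ^ 2 ≠ 0 := by
    have := Real.sin_sq_add_cos_sq (Real.pi / M i j)
    have : 1 - c ^ 2 = Real.sin (Real.pi / M i j) ^ 2 := by linarith
    rw [this]
    positivity
  obtain ⟨p, hp⟩ : ∃ p, p =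
    (geoForm M (simpleRoot i) x + c * geoForm M (simpleRoot j) x) / (1 - c ^ 2) := ⟨_, rfl⟩
  obtain ⟨q, hq⟩ : ∃ q, q =
    (geoForm M (simpleRoot j) x + c * geoForm M (simpleRoot i) x) / (1 - c ^ 2) := ⟨_, rfl⟩
  have hcij : geoForm M (simpleRoot i) (simpleRoot j) = -c := geoForm_simpleRoot M i j
  have hcji : geoForm M (simpleRoot j) (simpleRoot i) = -c := by rw [geoForm_comm, hcij]
  have hz := horth (x - p • simpleRoot i - q • simpleRoot j)
    (by simp only [map_sub, map_smul, geoForm_simpleRoot_self, hcij, smul_eq_mul, hp, hq]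
        field_simp
        ring)
    (by simp only [map_sub, map_smul, geoForm_simpleRoot_self, hcji, smul_eq_mul, hp, hq]
        field_simp
        ring) (M i j)
  simp only [map_sub, map_smul, hfi, hfj] at hz
  simpa using hz

/-- The geometric representation of a Coxeter group. -/
noncomputable def geoRep (cs : CoxeterSystem M W) : W →* Module.End ℝ (B → ℝ) :=
  cs.lift ⟨simpleRefl M, simpleRefl_isLiftable M⟩

lemma geoRep_simple (cs : CoxeterSystem M W) (i : B) :
    geoRep cs (cs.simple i) = simpleRefl M i :=
  cs.lift_apply_simple (simpleRefl_isLiftable M) i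

lemma geoRep_mul_apply (cs : CoxeterSystem M W) (g h : W) (x : B → ℝ) :
    geoRep cs (g * h) x = geoRep cs g (geoRep cs h x) := by
  rw [map_mul, Module.End.mul_apply]

lemma geoRep_inv_apply_apply (cs : CoxeterSystem M W) (g : W) (x : B → ℝ) :
    geoRep cs g⁻¹ (geoRep cs g x) = x := by
  rw [← geoRep_mul_apply, inv_mul_cancel, map_one, Module.End.one_apply]

lemma geoRep_apply_inv_apply (cs : CoxeterSystem M W) (g : W) (x : B → ℝ) :
    geoRep cs g (geoRep cs g⁻¹ x) = x := by
  rw [← geoRep_mul_apply, mul_inv_cancel, map_one, Module.End.one_apply]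

lemma geoForm_geoRep (cs : CoxeterSystem M W) (g : W) (x y : B → ℝ) :
    geoForm M (geoRep cs g x) (geoRep cs g y) = geoForm M x y := by
  induction g using cs.simple_induction generalizing x y with
  | simple i =>
    rw [geoRep_simple]
    simp only [simpleRefl_apply, map_sub, map_smul, LinearMap.sub_apply, LinearMap.smul_apply,
      geoForm_simpleRoot_self, smul_eq_mul, geoForm_comm M x (simpleRoot i)]
    ring
  | one => simp
  | mul g h hg hh => rw [geoRep_mul_apply, geoRep_mul_apply, hg, hh]

lemma dihedralCoeff_nonneg {m k : ℕ} (hm : m ≠ 1) (hk : m = 0 ∨ k ≤ m) :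
    0 ≤ dihedralCoeff (Real.cos (Real.pi / m)) k := by
  rcases Nat.eq_zero_or_pos m with rfl | h0
  · simp [dihedralCoeff_one]
  have hs := sin_pi_div_pos (show 2 ≤ m by omega)
  refine nonneg_of_mul_nonneg_left ?_ hs
  rw [dihedralCoeff_mul_sin]
  have hk' : (k : ℝ) ≤ m := by exact_mod_cast hk.resolve_left h0.ne'
  have hm' : (0 : ℝ) < m := by exact_mod_cast h0
  have := Real.pi_pos
  apply Real.sin_nonneg_of_nonneg_of_le_pi
  · positivity
  · rw [mul_div_assoc', div_le_iff₀ hm', mul_comm]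
    gcongr

lemma geoRep_alternatingWord (cs : CoxeterSystem M W) (i j : B) (k : ℕ) :
    geoRep cs (cs.wordProd (alternatingWord i j k)) (simpleRoot i) =
      dihedralCoeff (Real.cos (Real.pi / M i j)) (k + 1) •
          simpleRoot (if Even k then i else j) +
        dihedralCoeff (Real.cos (Real.pi / M i j)) k •
          simpleRoot (if Even k then j else i) := by
  induction k with
  | zero => simp [alternatingWord, dihedralCoeff]
  | succ k ih =>
    rw [alternatingWord_succ', cs.wordProd_cons, geoRep_mul_apply, ih, geoRep_simple]
    by_cases hk : Even k
    · have hk' : ¬ Even (k + 1) := by simpa [Nat.even_add_one] using hk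
      simp only [hk, hk', if_true, if_false]
      rw [simpleRefl_combination, dihedralCoeff, add_comm]
    · have hk' : Even (k + 1) := by simpa [Nat.even_add_one] using hk
      simp only [hk, hk', if_true, if_false]
      rw [simpleRefl_combination, dihedralCoeff, add_comm, M.symmetric j i]

theorem geoRep_simpleRoot_nonneg (cs : CoxeterSystem M W) (w : W) (i : B)
    (h : ¬ cs.IsRightDescent w i) : 0 ≤ geoRep cs w (simpleRoot i) := by
  induction hn : cs.length w using Nat.strong_induction_on generalizing w i with
  | _ n ih =>
  subst hn
  by_cases hw : w = 1
  · subst hw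
    simp [simpleRoot]
  obtain ⟨j, hj⟩ := cs.exists_rightDescent_of_ne_one hw
  have hij : i ≠ j := by rintro rfl; exact h hj
  let P (k : ℕ) : Prop := ∃ v, w = v * cs.wordProd (alternatingWord i j k) ∧
    cs.length w = cs.length v + k
  have hP1 : P 1 := by
    refine ⟨w * cs.simple j, ?_, ?_⟩
    · simp [alternatingWord]
    · exact (cs.isRightDescent_iff.1 hj).symm
  obtain ⟨k, ⟨v, hv, hl⟩, hk1, hmax⟩ : ∃ k, P k ∧ 1 ≤ k ∧ ¬ P (k + 1) := by
    by_contra! hcon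
    have : ∀ k, P (k + 1) := fun k => by
      induction k with
      | zero => exact hP1
      | succ k ihk => exact hcon _ ihk (by omega)
    obtain ⟨v, -, hl⟩ := this (cs.length w)
    omega
  obtain ⟨k, rfl⟩ : ∃ m, k = m + 1 := ⟨k - 1, by omega⟩
  have hlast : ¬ cs.IsRightDescent v (if Even (k + 1) then j else i) := fun hd => by
    refine hmax ⟨v * cs.simple (if Even (k + 1) then j else i), ?_, ?_⟩
    · rw [alternatingWord_succ', cs.wordProd_cons, mul_assoc, cs.simple_mul_simple_cancel_left, hv]
    · have := cs.isRightDescent_iff.1 hd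
      omega
  have hfirst : ¬ cs.IsRightDescent v (if Even k then j else i) := fun hd => by
    have h1 : w = (v * cs.simple (if Even k then j else i)) *
        cs.wordProd (alternatingWord i j k) := by
      rw [hv, alternatingWord_succ', cs.wordProd_cons, mul_assoc]
    have h2 := cs.length_mul_le (v * cs.simple (if Even k then j else i))
      (cs.wordProd (alternatingWord i j k))
    rw [← h1] at h2
    have h3 := cs.length_wordProd_le (alternatingWord i j k)
    rw [length_alternatingWord] at h3
    have := cs.isRightDescent_iff.1 hd
    omega
  have hvi : ¬ cs.IsRightDescent v i ∧ ¬ cs.IsRightDescent v j := by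
    by_cases hk : Even k
    · have hk' : ¬ Even (k + 1) := by simpa [Nat.even_add_one] using hk
      simp only [hk, hk', if_true, if_false] at hfirst hlast
      exact ⟨hlast, hfirst⟩
    · have hk' : Even (k + 1) := by simpa [Nat.even_add_one] using hk
      simp only [hk, hk', if_true, if_false] at hfirst hlast
      exact ⟨hfirst, hlast⟩
  have hi := ih _ (by omega) v i hvi.1 rfl
  have hj' := ih _ (by omega) v j hvi.2 rfl
  have hkm : M i j = 0 ∨ k + 2 ≤ M i j := by
    by_contra! hcon
    have hnr := cs.not_isReduced_alternatingWord j i (m := k + 2)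
      (by rw [M.symmetric]; exact hcon.1) (by rw [M.symmetric]; exact hcon.2)
    apply hnr
    have h1 : w * cs.simple i = v * cs.wordProd (alternatingWord j i (k + 2)) := by
      rw [alternatingWord_succ j i, cs.wordProd_concat, ← mul_assoc, ← hv]
    have h2 := cs.length_mul_le v (cs.wordProd (alternatingWord j i (k + 2)))
    rw [← h1, cs.not_isRightDescent_iff.1 h] at h2
    have h3 := cs.length_wordProd_le (alternatingWord j i (k + 2))
    rw [length_alternatingWord] at h3
    unfold CoxeterSystem.IsReduced
    rw [length_alternatingWord]
    omega
  have hm1 := M.off_diagonal i j hij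
  have c1 := dihedralCoeff_nonneg (k := k + 2) hm1 hkm
  have c2 := dihedralCoeff_nonneg (k := k + 1) hm1 (by omega)
  rw [hv, geoRep_mul_apply, geoRep_alternatingWord, map_add, map_smul, map_smul]
  refine add_nonneg (smul_nonneg c1 ?_) (smul_nonneg c2 ?_) <;> split_ifs <;> assumption

/-! ### Roots -/

lemma isRightDescent_iff_geoRep_nonpos (cs : CoxeterSystem M W) (w : W) (i : B) :
    cs.IsRightDescent w i ↔ geoRep cs w (simpleRoot i) ≤ 0 := by
  have hne : geoRep cs w (simpleRoot i) ≠ 0 := fun h => by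
    have := geoForm_geoRep cs w (simpleRoot i) (simpleRoot i)
    rw [h, geoForm_simpleRoot_self] at this
    simp at this
  constructor
  · intro h
    have h1 := geoRep_simpleRoot_nonneg cs (w * cs.simple i) i
      (cs.isRightDescent_iff_not_isRightDescent_mul.1 h)
    rw [geoRep_mul_apply, geoRep_simple, simpleRefl_self, map_neg] at h1
    exact neg_nonneg.1 h1
  · intro h
    by_contra hd
    exact hne (le_antisymm h (geoRep_simpleRoot_nonneg cs w i hd))

/-- The set of roots of the geometric representation. -/
def roots (cs : CoxeterSystem M W) : Set (B → ℝ) :=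
  {x | ∃ w i, x = geoRep cs w (simpleRoot i)}

lemma simpleRoot_mem_roots (cs : CoxeterSystem M W) (i : B) : simpleRoot i ∈ roots cs :=
  ⟨1, i, by simp⟩

lemma geoRep_mem_roots (cs : CoxeterSystem M W) (g : W) {x : B → ℝ} (hx : x ∈ roots cs) :
    geoRep cs g x ∈ roots cs := by
  obtain ⟨w, i, rfl⟩ := hx
  exact ⟨g * w, i, (geoRep_mul_apply cs g w _).symm⟩

lemma geoForm_root_self (cs : CoxeterSystem M W) {x : B → ℝ} (hx : x ∈ roots cs) :
    geoForm M x x = 1 := by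
  obtain ⟨w, i, rfl⟩ := hx
  rw [geoForm_geoRep, geoForm_simpleRoot_self]

lemma root_ne_zero (cs : CoxeterSystem M W) {x : B → ℝ} (hx : x ∈ roots cs) : x ≠ 0 := by
  rintro rfl
  simpa using geoForm_root_self cs hx

lemma root_nonneg_or_nonpos (cs : CoxeterSystem M W) {x : B → ℝ} (hx : x ∈ roots cs) :
    0 ≤ x ∨ x ≤ 0 := by
  obtain ⟨w, i, rfl⟩ := hx
  by_cases h : cs.IsRightDescent w i
  · exact Or.inr ((isRightDescent_iff_geoRep_nonpos cs w i).1 h)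
  · exact Or.inl (geoRep_simpleRoot_nonneg cs w i h)

lemma not_nonpos_of_nonneg (cs : CoxeterSystem M W) {x : B → ℝ} (hx : x ∈ roots cs)
    (h : 0 ≤ x) : ¬ x ≤ 0 :=
  fun h' => root_ne_zero cs hx (le_antisymm h' h)

lemma exists_pos_coord (cs : CoxeterSystem M W) {x : B → ℝ} (hx : x ∈ roots cs)
    (h : 0 ≤ x) : ∃ i, 0 < x i := by
  by_contra! hcon
  exact not_nonpos_of_nonneg cs hx h hcon

/-- The group element acting as the reflection in a given root. -/
lemma exists_reflection (cs : CoxeterSystem M W) {x : B → ℝ} (hx : x ∈ roots cs) :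
    ∃ t : W, ∀ y, geoRep cs t y = y - (2 * geoForm M x y) • x := by
  obtain ⟨w, i, rfl⟩ := hx
  refine ⟨w * cs.simple i * w⁻¹, fun y => ?_⟩
  rw [geoRep_mul_apply, geoRep_mul_apply, geoRep_simple, simpleRefl_apply, map_sub, map_smul,
    geoRep_apply_inv_apply, ← geoForm_geoRep cs w (simpleRoot i), geoRep_apply_inv_apply]

lemma neg_mem_roots (cs : CoxeterSystem M W) {x : B → ℝ} (hx : x ∈ roots cs) :
    -x ∈ roots cs := by
  obtain ⟨t, ht⟩ := exists_reflection cs hx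
  have h := geoRep_mem_roots cs t hx
  rw [ht, geoForm_root_self cs hx] at h
  convert h using 1
  module

lemma exists_pos_coord_ne (cs : CoxeterSystem M W) {x : B → ℝ} (hx : x ∈ roots cs)
    (h : 0 ≤ x) {i : B} (hne : x ≠ simpleRoot i) : ∃ j ≠ i, 0 < x j := by
  by_contra! hcon
  have hxe : x = x i • simpleRoot i := by
    ext j
    by_cases hj : j = i
    · subst hj
      simp [simpleRoot]
    · simpa [simpleRoot, hj] using le_antisymm (hcon j hj) (h j)
  have h1 := geoForm_root_self cs hx
  have h0 : 0 ≤ x i := h i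
  rw [hxe] at h1
  simp only [map_smul, LinearMap.smul_apply, geoForm_simpleRoot_self, smul_eq_mul, mul_one] at h1
  have h2 : x i = 1 := by nlinarith
  rw [h2, one_smul] at hxe
  exact hne hxe

lemma sub_smul_simpleRoot_nonneg (cs : CoxeterSystem M W) {x : B → ℝ} (hx : x ∈ roots cs)
    (h : 0 ≤ x) {i : B} (hne : x ≠ simpleRoot i) {c : ℝ}
    (hy : x - c • simpleRoot i ∈ roots cs) : 0 ≤ x - c • simpleRoot i := by
  obtain ⟨j, hji, hj⟩ := exists_pos_coord_ne cs hx h hne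
  refine (root_nonneg_or_nonpos cs hy).resolve_right fun hneg => ?_
  have := hneg j
  simp [simpleRoot, hji] at this
  linarith

lemma geoRep_simple_nonneg (cs : CoxeterSystem M W) {x : B → ℝ} (hx : x ∈ roots cs)
    (h : 0 ≤ x) {i : B} (hne : x ≠ simpleRoot i) : 0 ≤ geoRep cs (cs.simple i) x := by
  have h1 := geoRep_mem_roots cs (cs.simple i) hx
  rw [geoRep_simple, simpleRefl_apply] at h1 ⊢
  exact sub_smul_simpleRoot_nonneg cs hx h hne h1

lemma geoRep_simple_self (cs : CoxeterSystem M W) (i : B) :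
    geoRep cs (cs.simple i) (simpleRoot i) = -simpleRoot i := by
  rw [geoRep_simple, simpleRefl_self]

lemma geoRep_simple_geoRep_simple (cs : CoxeterSystem M W) (i : B) (x : B → ℝ) :
    geoRep cs (cs.simple i) (geoRep cs (cs.simple i) x) = x := by
  rw [geoRep_simple, simpleRefl_simpleRefl]

lemma simpleRoot_nonneg (i : B) : 0 ≤ (simpleRoot i : B → ℝ) := by
  simp [simpleRoot]

/-- The set of positive roots made negative by `w`. -/
def inversions (cs : CoxeterSystem M W) (w : W) : Set (B → ℝ) :=
  {x | x ∈ roots cs ∧ 0 ≤ x ∧ geoRep cs w x ≤ 0}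

lemma finite_inversions (cs : CoxeterSystem M W) (w : W) : (inversions cs w).Finite := by
  induction w using cs.simple_induction_right with
  | one =>
    refine Set.finite_empty.subset fun x hx => ?_
    simp only [inversions, map_one, Module.End.one_apply] at hx
    exact not_nonpos_of_nonneg cs hx.1 hx.2.1 hx.2.2
  | mul_simple_right w i ih =>
    refine ((ih.image (geoRep cs (cs.simple i))).insert (simpleRoot i)).subset ?_
    rintro x ⟨hx, h0, hw⟩
    by_cases hne : x = simpleRoot i
    · exact Or.inl hne
    · refine Or.inr ⟨geoRep cs (cs.simple i) x, ⟨geoRep_mem_roots cs _ hx,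
        geoRep_simple_nonneg cs hx h0 hne, ?_⟩, geoRep_simple_geoRep_simple cs i x⟩
      rwa [← geoRep_mul_apply]

lemma exists_large_combination (cs : CoxeterSystem M W) {x y : B → ℝ} (hx : x ∈ roots cs)
    (hy : y ∈ roots cs) (hxy : geoForm M x y ≤ -1) (n : ℕ) :
    ∃ p q : ℝ, (n : ℝ) ≤ p ∧ 0 ≤ q ∧ q + 1 ≤ p ∧ p • x + q • y ∈ roots cs := by
  obtain ⟨s, hs⟩ := exists_reflection cs hx
  obtain ⟨t, ht⟩ := exists_reflection cs hy
  induction n with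
  | zero => exact ⟨1, 0, by simp, le_rfl, by simp, by simpa using hx⟩
  | succ n ih =>
    obtain ⟨p, q, hp, hq, hpq, h⟩ := ih
    obtain ⟨c, hc⟩ : ∃ c, c = -geoForm M x y := ⟨_, rfl⟩
    have hc1 : 1 ≤ c := by linarith
    have hst := geoRep_mem_roots cs s (geoRep_mem_roots cs t h)
    have hxy' : geoForm M x y = -c := by linarith
    have hyx' : geoForm M y x = -c := by rw [geoForm_comm, hxy']
    have h1 : p + 1 ≤ 2 * c * p - q := by nlinarith
    have h2 : (2 * c * p - q) + 1 ≤ 2 * c * (2 * c * p - q) - p := by nlinarith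
    refine ⟨2 * c * (2 * c * p - q) - p, 2 * c * p - q, ?_, ?_, h2, ?_⟩
    · push_cast
      linarith
    · linarith
    · convert hst using 1
      rw [ht, hs]
      simp only [map_add, map_sub, map_smul, hxy', hyx', geoForm_root_self cs hx,
        geoForm_root_self cs hy, smul_eq_mul]
      module

/-- Two roots whose span is not positive definite and which form an obtuse pair cannot both
change sign between two chambers. -/
lemma false_of_geoForm_le_neg_one (cs : CoxeterSystem M W) {x y : B → ℝ} (hx : x ∈ roots cs)
    (hy : y ∈ roots cs) (hxy : geoForm M x y ≤ -1) {p q : W}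
    (hqx : 0 ≤ geoRep cs q x) (hqy : 0 ≤ geoRep cs q y)
    (hpx : geoRep cs p x ≤ 0) (hpy : geoRep cs p y ≤ 0) : False := by
  obtain ⟨j, hj⟩ := exists_pos_coord cs (geoRep_mem_roots cs q hx) hqx
  obtain ⟨C, hC⟩ := ((finite_inversions cs (p * q⁻¹)).image fun z => z j).bddAbove
  obtain ⟨n, hn⟩ := exists_nat_gt (C / geoRep cs q x j)
  obtain ⟨a, b, ha, hb, -, hab⟩ := exists_large_combination cs hx hy hxy n
  have ha0 : 0 ≤ a := le_trans (Nat.cast_nonneg n) ha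
  have hmem : geoRep cs q (a • x + b • y) ∈ inversions cs (p * q⁻¹) := by
    refine ⟨geoRep_mem_roots cs q hab, ?_, ?_⟩
    · rw [map_add, map_smul, map_smul]
      exact add_nonneg (smul_nonneg ha0 hqx) (smul_nonneg hb hqy)
    · rw [← geoRep_mul_apply, inv_mul_cancel_right, map_add, map_smul, map_smul]
      exact add_nonpos (smul_nonpos_of_nonneg_of_nonpos ha0 hpx)
        (smul_nonpos_of_nonneg_of_nonpos hb hpy)
  have h1 : geoRep cs q (a • x + b • y) j ≤ C := hC ⟨_, hmem, rfl⟩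
  rw [map_add, map_smul, map_smul] at h1
  simp only [Pi.add_apply, Pi.smul_apply, smul_eq_mul] at h1
  have h2 : 0 ≤ b * geoRep cs q y j := mul_nonneg hb (hqy j)
  rw [div_lt_iff₀ hj] at hn
  nlinarith

/-! ### Elementary roots -/

/-- The elementary roots: the positive roots that dominate no other positive root. -/
def elementaryRoots (cs : CoxeterSystem M W) : Set (B → ℝ) :=
  {x | x ∈ roots cs ∧ 0 ≤ x ∧ ∀ y ∈ roots cs, 0 ≤ y →
    (∀ g, geoRep cs g x ≤ 0 → geoRep cs g y ≤ 0) → y = x}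

lemma simpleRoot_mem_elementaryRoots (cs : CoxeterSystem M W) (i : B) :
    simpleRoot i ∈ elementaryRoots cs := by
  refine ⟨simpleRoot_mem_roots cs i, simpleRoot_nonneg i, fun y hy h0 h => ?_⟩
  by_contra hne
  refine not_nonpos_of_nonneg cs (geoRep_mem_roots cs _ hy) (geoRep_simple_nonneg cs hy h0 hne)
    (h (cs.simple i) ?_)
  rw [geoRep_simple_self]
  exact neg_nonpos.2 (simpleRoot_nonneg i)

/-- If `x` is elementary but its image under a simple reflection is not, then this image
dominates the corresponding simple root. -/
lemma simpleRoot_nonpos_of_not_mem_elementaryRoots (cs : CoxeterSystem M W) {x : B → ℝ}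
    (hx : x ∈ elementaryRoots cs) {i : B} (hne : x ≠ simpleRoot i)
    (hns : geoRep cs (cs.simple i) x ∉ elementaryRoots cs) {g : W}
    (hg : geoRep cs g (geoRep cs (cs.simple i) x) ≤ 0) : geoRep cs g (simpleRoot i) ≤ 0 := by
  have hsx := geoRep_simple_nonneg cs hx.1 hx.2.1 hne
  have : ∃ y ∈ roots cs, 0 ≤ y ∧ (∀ g, geoRep cs g (geoRep cs (cs.simple i) x) ≤ 0 →
      geoRep cs g y ≤ 0) ∧ y ≠ geoRep cs (cs.simple i) x := by
    by_contra! hcon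
    exact hns ⟨geoRep_mem_roots cs _ hx.1, hsx, hcon⟩
  obtain ⟨y, hy, h0, hdom, hyne⟩ := this
  by_cases hyi : y = simpleRoot i
  · exact hyi ▸ hdom g hg
  · refine absurd ?_ hyne
    have h1 := hx.2.2 _ (geoRep_mem_roots cs (cs.simple i) hy)
      (geoRep_simple_nonneg cs hy h0 hyi) (fun h hh => by
        rw [← geoRep_mul_apply]
        apply hdom
        rwa [geoRep_mul_apply, geoRep_simple_geoRep_simple])
    rw [← h1, geoRep_simple_geoRep_simple]

lemma geoForm_simpleRoot_lt_one (cs : CoxeterSystem M W) {x : B → ℝ}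
    (hx : x ∈ elementaryRoots cs) {i : B} (hne : x ≠ simpleRoot i) :
    geoForm M x (simpleRoot i) < 1 := by
  by_contra! hc
  refine hne (hx.2.2 _ (simpleRoot_mem_roots cs i) (simpleRoot_nonneg i) fun g hg => ?_).symm
  by_contra hgi
  have hgi' := (root_nonneg_or_nonpos cs
    (geoRep_mem_roots cs g (simpleRoot_mem_roots cs i))).resolve_right hgi
  refine false_of_geoForm_le_neg_one cs hx.1 (neg_mem_roots cs (simpleRoot_mem_roots cs i))
    (p := g) (q := cs.simple i) ?_ (geoRep_simple_nonneg cs hx.1 hx.2.1 hne) ?_ hg ?_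
  · simpa using hc
  · rw [map_neg, geoRep_simple_self, neg_neg]
    exact simpleRoot_nonneg i
  · rw [map_neg]
    exact neg_nonpos.2 hgi'

lemma geoRep_simple_mem_elementaryRoots (cs : CoxeterSystem M W) {x : B → ℝ}
    (hx : x ∈ elementaryRoots cs) {i : B} (hne : x ≠ simpleRoot i)
    (hc : 0 < geoForm M x (simpleRoot i)) :
    geoRep cs (cs.simple i) x ∈ elementaryRoots cs := by
  by_contra hns
  obtain ⟨t, ht⟩ := exists_reflection cs hx.1
  have h := simpleRoot_nonpos_of_not_mem_elementaryRoots cs hx hne hns (g := t * cs.simple i) (by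
    rw [← geoRep_mul_apply, mul_assoc, cs.simple_mul_simple_self, mul_one, ht,
      geoForm_root_self cs hx.1, show x - (2 * 1 : ℝ) • x = -x by module]
    exact neg_nonpos.2 hx.2.1)
  rw [geoRep_mul_apply, geoRep_simple_self, map_neg, neg_nonpos, ht] at h
  obtain ⟨j, hji, hj⟩ := exists_pos_coord_ne cs hx.1 hx.2.1 hne
  have := h j
  simp [simpleRoot, hji] at this
  rw [simpleRoot] at hc
  nlinarith

/-- The elementary inversions of a group element. -/
def elementaryInversions (cs : CoxeterSystem M W) (g : W) : Set (B → ℝ) :=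
  {x | x ∈ elementaryRoots cs ∧ geoRep cs g x ≤ 0}

lemma isRightDescent_iff_mem_elementaryInversions (cs : CoxeterSystem M W) (g : W) (i : B) :
    cs.IsRightDescent g i ↔ simpleRoot i ∈ elementaryInversions cs g := by
  rw [isRightDescent_iff_geoRep_nonpos]
  exact ⟨fun h => ⟨simpleRoot_mem_elementaryRoots cs i, h⟩, fun h => h.2⟩

lemma mem_elementaryInversions_mul_simple (cs : CoxeterSystem M W) {g : W} {i : B}
    (hg : ¬ cs.IsRightDescent g i) (x : B → ℝ) :
    x ∈ elementaryInversions cs (g * cs.simple i) ↔ x ∈ elementaryRoots cs ∧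
      (x = simpleRoot i ∨ geoRep cs (cs.simple i) x ∈ elementaryInversions cs g) := by
  refine and_congr_right fun hx => ?_
  rw [geoRep_mul_apply]
  by_cases hxi : x = simpleRoot i
  · subst hxi
    simp only [true_or, iff_true, geoRep_simple_self, map_neg]
    exact neg_nonpos.2 (geoRep_simpleRoot_nonneg cs g i hg)
  · refine ⟨fun h => Or.inr ⟨?_, h⟩, fun h => (h.resolve_left hxi).2⟩
    by_contra hns
    exact hg ((isRightDescent_iff_geoRep_nonpos cs g i).2
      (simpleRoot_nonpos_of_not_mem_elementaryRoots cs hx hxi hns h))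

lemma elementaryInversions_mul_simple_congr (cs : CoxeterSystem M W) {g h : W} {i : B}
    (hgh : elementaryInversions cs g = elementaryInversions cs h)
    (hg : ¬ cs.IsRightDescent g i) :
    elementaryInversions cs (g * cs.simple i) = elementaryInversions cs (h * cs.simple i) := by
  have hh : ¬ cs.IsRightDescent h i := by
    rwa [isRightDescent_iff_mem_elementaryInversions, ← hgh,
      ← isRightDescent_iff_mem_elementaryInversions]
  ext x
  rw [mem_elementaryInversions_mul_simple cs hg, mem_elementaryInversions_mul_simple cs hh, hgh]

/-! ### Finiteness of the values of the form on pairs of intersecting hyperplanes -/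

/-- A linear functional which is positive on all but finitely many positive roots. -/
def IsTame (cs : CoxeterSystem M W) (f : (B → ℝ) →ₗ[ℝ] ℝ) : Prop :=
  {x | x ∈ roots cs ∧ 0 ≤ x ∧ f x ≤ 0}.Finite

lemma isTame_sum_proj (cs : CoxeterSystem M W) : IsTame cs (∑ i, LinearMap.proj i) := by
  refine Set.finite_empty.subset ?_
  rintro x ⟨hx, h0, hf⟩
  obtain ⟨i, hi⟩ := exists_pos_coord cs hx h0
  simp only [LinearMap.sum_apply, LinearMap.proj_apply] at hf
  have := Finset.single_le_sum (f := x) (fun j _ => h0 j) (Finset.mem_univ i)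
  exact absurd hi (not_lt.2 (this.trans hf))

lemma IsTame.comp_geoRep {cs : CoxeterSystem M W} {f : (B → ℝ) →ₗ[ℝ] ℝ} (hf : IsTame cs f)
    (w : W) : IsTame cs (f ∘ₗ geoRep cs w) := by
  refine ((finite_inversions cs w).union (hf.image (geoRep cs w⁻¹))).subset ?_
  rintro x ⟨hx, h0, hfx⟩
  rcases root_nonneg_or_nonpos cs (geoRep_mem_roots cs w hx) with h | h
  · exact Or.inr ⟨_, ⟨geoRep_mem_roots cs w hx, h, hfx⟩, geoRep_inv_apply_apply cs w x⟩
  · exact Or.inl ⟨hx, h0, h⟩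

lemma IsTame.smul_add {cs : CoxeterSystem M W} {f g : (B → ℝ) →ₗ[ℝ] ℝ} (hf : IsTame cs f)
    (hg : IsTame cs g) {a : ℝ} (ha : 0 ≤ a) : IsTame cs (a • f + g) := by
  refine (hf.union hg).subset ?_
  rintro x ⟨hx, h0, hfx⟩
  simp only [LinearMap.add_apply, LinearMap.smul_apply, smul_eq_mul] at hfx
  rcases le_or_gt (f x) 0 with h | h
  · exact Or.inl ⟨hx, h0, h⟩
  · exact Or.inr ⟨hx, h0, by nlinarith [mul_nonneg ha h.le]⟩

lemma IsTame.add {cs : CoxeterSystem M W} {f g : (B → ℝ) →ₗ[ℝ] ℝ} (hf : IsTame cs f)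
    (hg : IsTame cs g) : IsTame cs (f + g) := by
  simpa using hf.smul_add hg zero_le_one

lemma exists_isTame_eq_zero (cs : CoxeterSystem M W) {x : B → ℝ} (hx : x ∈ roots cs) :
    ∃ f, IsTame cs f ∧ f x = 0 := by
  obtain ⟨t, ht⟩ := exists_reflection cs hx
  refine ⟨_, (isTame_sum_proj cs).add ((isTame_sum_proj cs).comp_geoRep t), ?_⟩
  rw [LinearMap.add_apply, LinearMap.comp_apply, ht, geoForm_root_self cs hx, map_sub, map_smul,
    smul_eq_mul]
  ring

lemma exists_isTame_eq_zero_pair (cs : CoxeterSystem M W) {x : B → ℝ} (hx : x ∈ roots cs)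
    (n : ℕ) : ∀ y ∈ roots cs, 1 ≤ 2 ^ n * (1 - |geoForm M x y|) →
      ∃ f, IsTame cs f ∧ f x = 0 ∧ f y = 0 := by
  have key : ∀ y ∈ roots cs, 2 * geoForm M x y ^ 2 ≤ 1 →
      ∃ f, IsTame cs f ∧ f x = 0 ∧ f y = 0 := by
    intro y hy hc
    obtain ⟨s, hs⟩ := exists_reflection cs hx
    obtain ⟨t, ht⟩ := exists_reflection cs hy
    obtain ⟨f, hf, hfx⟩ := exists_isTame_eq_zero cs hx
    refine ⟨(2 - 4 * geoForm M x y ^ 2) • f +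
      (f ∘ₗ geoRep cs t + (f ∘ₗ geoRep cs t) ∘ₗ geoRep cs s),
      hf.smul_add ((hf.comp_geoRep t).add ((hf.comp_geoRep t).comp_geoRep s)) (by linarith), ?_, ?_⟩
    all_goals
      simp only [LinearMap.add_apply, LinearMap.smul_apply, LinearMap.comp_apply, ht, hs, map_sub,
        map_smul, smul_eq_mul, hfx, geoForm_root_self cs hx, geoForm_root_self cs hy,
        geoForm_comm M y x]
      ring
  induction n with
  | zero =>
    intro y hy h
    have h0 : geoForm M x y = 0 := abs_nonpos_iff.1 (by linarith [h])
    exact key y hy (by rw [h0]; norm_num)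
  | succ n ih =>
    intro y hy h
    by_cases hc : 2 * geoForm M x y ^ 2 ≤ 1
    · exact key y hy hc
    · obtain ⟨t, ht⟩ := exists_reflection cs hy
      have hval : geoForm M x (geoRep cs t x) = 1 - 2 * geoForm M x y ^ 2 := by
        rw [ht, map_sub, map_smul, geoForm_root_self cs hx, geoForm_comm M y x, smul_eq_mul]
        ring
      have hpow : (0 : ℝ) < 2 ^ n := by positivity
      obtain ⟨f, hf, hfx, hfy⟩ := ih _ (geoRep_mem_roots cs t hx) (by
        rw [hval, abs_of_nonpos (by linarith)]
        rw [pow_succ] at h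
        have h1 : |geoForm M x y| < 1 := by
          by_contra! h1
          nlinarith
        have h2 := sq_abs (geoForm M x y)
        have h3 := abs_nonneg (geoForm M x y)
        have h4 : 2 * (1 - |geoForm M x y|) ≤ 1 - -(1 - 2 * geoForm M x y ^ 2) := by
          rw [← h2]
          nlinarith
        calc (1 : ℝ) ≤ 2 ^ n * (2 * (1 - |geoForm M x y|)) := by linarith
          _ ≤ _ := mul_le_mul_of_nonneg_left h4 hpow.le)
      refine ⟨f, hf, hfx, ?_⟩
      rw [ht, map_sub, map_smul, hfx, zero_sub, neg_eq_zero, smul_eq_mul, mul_eq_zero] at hfy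
      refine hfy.resolve_left fun h0 => hc ?_
      rw [geoForm_comm M y x] at h0
      have : geoForm M x y = 0 := by linarith
      rw [this]
      norm_num

lemma exists_comp_geoRep_nonneg (cs : CoxeterSystem M W) (f : (B → ℝ) →ₗ[ℝ] ℝ)
    (hf : IsTame cs f) : ∃ w, ∀ i, 0 ≤ f (geoRep cs w (simpleRoot i)) := by
  induction hn : {x | x ∈ roots cs ∧ 0 ≤ x ∧ f x < 0}.ncard using Nat.strong_induction_on
    generalizing f with
  | _ n ih =>
    by_cases hdom : ∀ i, 0 ≤ f (simpleRoot i)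
    · exact ⟨1, by simpa using hdom⟩
    · push Not at hdom
      obtain ⟨i, hi⟩ := hdom
      have hfin : {x | x ∈ roots cs ∧ 0 ≤ x ∧ f x < 0}.Finite :=
        hf.subset fun x hx => ⟨hx.1, hx.2.1, hx.2.2.le⟩
      have hinj : Function.Injective (geoRep cs (cs.simple i)) :=
        Function.Involutive.injective (geoRep_simple_geoRep_simple cs i)
      obtain ⟨w, hw⟩ := ih _ (by
        rw [← hn, ← Set.ncard_image_of_injective _ hinj]
        refine Set.ncard_lt_ncard (Set.ssubset_iff_exists.2 ⟨?_, simpleRoot i,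
          ⟨simpleRoot_mem_roots cs i, simpleRoot_nonneg i, hi⟩, ?_⟩) hfin
        · rintro _ ⟨x, ⟨hx, h0, hfx⟩, rfl⟩
          refine ⟨geoRep_mem_roots cs _ hx, geoRep_simple_nonneg cs hx h0 ?_, hfx⟩
          rintro rfl
          rw [LinearMap.comp_apply, geoRep_simple_self, map_neg] at hfx
          linarith
        · rintro ⟨x, ⟨hx, h0, hfx⟩, hxi⟩
          have h1 := congrArg (geoRep cs (cs.simple i)) hxi
          rw [geoRep_simple_geoRep_simple, geoRep_simple_self] at h1
          refine not_nonpos_of_nonneg cs hx h0 ?_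
          rw [h1]
          exact neg_nonpos.2 (simpleRoot_nonneg i)) (f ∘ₗ geoRep cs (cs.simple i))
          (hf.comp_geoRep _) rfl
      exact ⟨cs.simple i * w, fun j => by rw [geoRep_mul_apply]; exact hw j⟩

/-- The roots in the span of the simple roots indexed by `I`. -/
def rootsOn (cs : CoxeterSystem M W) (I : Set B) : Set (B → ℝ) :=
  {x | x ∈ roots cs ∧ ∀ i ∉ I, x i = 0}

lemma mem_rootsOn_of_apply_eq_zero (cs : CoxeterSystem M W) {f : (B → ℝ) →ₗ[ℝ] ℝ}
    (hf : ∀ i, 0 ≤ f (simpleRoot i)) {x : B → ℝ} (hx : x ∈ roots cs) (hfx : f x = 0) :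
    x ∈ rootsOn cs {i | f (simpleRoot i) = 0} := by
  refine ⟨hx, fun i hi => ?_⟩
  have h0 : ∀ i, x i * f (simpleRoot i) = 0 := by
    have hs : ∑ i, x i * f (simpleRoot i) = 0 := by
      rw [← hfx, linearMap_eq_sum f x]
      rfl
    rcases root_nonneg_or_nonpos cs hx with h | h
    · exact fun i => (Finset.sum_eq_zero_iff_of_nonneg
        fun i _ => mul_nonneg (h i) (hf i)).1 hs i (Finset.mem_univ i)
    · exact fun i => (Finset.sum_eq_zero_iff_of_nonpos
        fun i _ => mul_nonpos_of_nonpos_of_nonneg (h i) (hf i)).1 hs i (Finset.mem_univ i)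
  exact (mul_eq_zero.1 (h0 i)).resolve_right hi

lemma finite_rootsOn_of_isTame (cs : CoxeterSystem M W) {f : (B → ℝ) →ₗ[ℝ] ℝ}
    (hf : IsTame cs f) : (rootsOn cs {i | f (simpleRoot i) = 0}).Finite := by
  refine (hf.union (hf.image Neg.neg)).subset ?_
  rintro x ⟨hx, hI⟩
  have hfx : f x = 0 := by
    rw [linearMap_eq_sum f x]
    refine Finset.sum_eq_zero fun i _ => ?_
    by_cases hi : f (simpleRoot i) = 0
    · rw [hi, smul_zero]
    · rw [hI i hi, zero_smul]
  rcases root_nonneg_or_nonpos cs hx with h | h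
  · exact Or.inl ⟨hx, h, hfx.le⟩
  · exact Or.inr ⟨-x, ⟨neg_mem_roots cs hx, neg_nonneg.2 h, by rw [map_neg, hfx, neg_zero]⟩,
      neg_neg x⟩

/-- The form takes only finitely many values in `(-1, 1)` on pairs of roots. -/
lemma finite_geoForm_values (cs : CoxeterSystem M W) :
    {c | |c| < 1 ∧ ∃ x ∈ roots cs, ∃ y ∈ roots cs, c = geoForm M x y}.Finite := by
  have hfin : (⋃ I ∈ {I : Set B | (rootsOn cs I).Finite},
      Set.image2 (fun x y => geoForm M x y) (rootsOn cs I) (rootsOn cs I)).Finite :=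
    (Set.toFinite _).biUnion fun I hI => Set.Finite.image2 _ hI hI
  refine hfin.subset ?_
  rintro c ⟨hc, x, hx, y, hy, rfl⟩
  obtain ⟨n, hn⟩ := pow_unbounded_of_one_lt (1 / (1 - |geoForm M x y|)) (one_lt_two (α := ℝ))
  rw [div_lt_iff₀ (by linarith)] at hn
  obtain ⟨f, hf, hfx, hfy⟩ := exists_isTame_eq_zero_pair cs hx n y hy hn.le
  obtain ⟨w, hw⟩ := exists_comp_geoRep_nonneg cs f hf
  have hmem : ∀ z ∈ roots cs, f z = 0 → geoRep cs w⁻¹ z ∈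
      rootsOn cs {i | (f ∘ₗ geoRep cs w) (simpleRoot i) = 0} := fun z hz hfz =>
    mem_rootsOn_of_apply_eq_zero cs hw (geoRep_mem_roots cs _ hz)
      (by rwa [LinearMap.comp_apply, geoRep_apply_inv_apply])
  refine Set.mem_biUnion (finite_rootsOn_of_isTame cs (hf.comp_geoRep w))
    ⟨_, hmem x hx hfx, _, hmem y hy hfy, ?_⟩
  exact geoForm_geoRep cs w⁻¹ x y

/-! ### Finiteness of the set of elementary roots -/

/-- The depth of a positive root: the least length of a group element making it negative. -/
noncomputable def depth (cs : CoxeterSystem M W) (x : B → ℝ) : ℕ :=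
  sInf {n | ∃ w, geoRep cs w x ≤ 0 ∧ cs.length w = n}

lemma exists_length_eq_depth (cs : CoxeterSystem M W) {x : B → ℝ} (hx : x ∈ roots cs)
    (h0 : 0 ≤ x) : ∃ w, geoRep cs w x ≤ 0 ∧ cs.length w = depth cs x := by
  obtain ⟨t, ht⟩ := exists_reflection cs hx
  refine Nat.sInf_mem (s := {n | ∃ w, geoRep cs w x ≤ 0 ∧ cs.length w = n}) ⟨_, t, ?_, rfl⟩
  rw [ht, geoForm_root_self cs hx, show x - (2 * 1 : ℝ) • x = -x by module]
  exact neg_nonpos.2 h0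

lemma depth_le (cs : CoxeterSystem M W) {x : B → ℝ} {w : W} (hw : geoRep cs w x ≤ 0) :
    depth cs x ≤ cs.length w :=
  Nat.sInf_le ⟨w, hw, rfl⟩

/-- `y` is obtained from `x` by a simple reflection `i` which strictly increases the depth,
both being elementary roots. -/
structure ElementaryStep (cs : CoxeterSystem M W) (i : B) (x y : B → ℝ) : Prop where
  left_mem : x ∈ elementaryRoots cs
  right_mem : y ∈ elementaryRoots cs
  eq : y = geoRep cs (cs.simple i) x
  neg_one_lt : -1 < geoForm M x (simpleRoot i)
  lt_zero : geoForm M x (simpleRoot i) < 0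
  depth_lt : depth cs x < depth cs y

lemma exists_elementaryStep (cs : CoxeterSystem M W) {x : B → ℝ} (hx : x ∈ elementaryRoots cs)
    (hne : ∀ i, x ≠ simpleRoot i) : ∃ i y, ElementaryStep cs i y x := by
  obtain ⟨w, hw, hl⟩ := exists_length_eq_depth cs hx.1 hx.2.1
  have hw1 : w ≠ 1 := by
    rintro rfl
    exact not_nonpos_of_nonneg cs hx.1 hx.2.1 (by simpa using hw)
  obtain ⟨i, hi⟩ := cs.exists_rightDescent_of_ne_one hw1
  have hi' := (isRightDescent_iff_geoRep_nonpos cs w i).1 hi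
  have hlt : cs.length (w * cs.simple i) < depth cs x := hl ▸ hi
  have hnot : ¬ geoRep cs (w * cs.simple i) x ≤ 0 := fun h => (depth_le cs h).not_gt hlt
  have hpos : 0 < geoForm M x (simpleRoot i) := by
    by_contra! hc
    apply hnot
    rw [geoRep_mul_apply, geoRep_simple, simpleRefl_apply, map_sub, map_smul, geoForm_comm]
    have h1 : 0 ≤ (2 * geoForm M x (simpleRoot i)) • geoRep cs w (simpleRoot i) :=
      smul_nonneg_of_nonpos_of_nonpos (by linarith) hi'
    exact (sub_le_self _ h1).trans hw
  have hval : geoForm M (geoRep cs (cs.simple i) x) (simpleRoot i) =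
      -geoForm M x (simpleRoot i) := by
    rw [← geoForm_geoRep cs (cs.simple i), geoRep_simple_geoRep_simple, geoRep_simple_self,
      map_neg]
  refine ⟨i, geoRep cs (cs.simple i) x, geoRep_simple_mem_elementaryRoots cs hx (hne i) hpos, hx,
    (geoRep_simple_geoRep_simple cs i x).symm, ?_, ?_, (depth_le cs ?_).trans_lt hlt⟩
  · rw [hval]
    linarith [geoForm_simpleRoot_lt_one cs hx (hne i)]
  · rw [hval]
    linarith
  · rwa [geoRep_mul_apply, geoRep_simple_geoRep_simple]

lemma ElementaryStep.geoForm_le {cs : CoxeterSystem M W} {i j : B} {x y : B → ℝ}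
    (h : ElementaryStep cs i x y) (hij : i ≠ j) :
    geoForm M y (simpleRoot j) ≤ geoForm M x (simpleRoot j) := by
  rw [h.eq, geoRep_simple, simpleRefl_apply, geoForm_comm M (simpleRoot i) x]
  simp only [map_sub, map_smul, LinearMap.sub_apply, LinearMap.smul_apply, smul_eq_mul]
  nlinarith [h.lt_zero, geoForm_simpleRoot_nonpos M hij]

lemma eq_of_geoForm_eq_one (cs : CoxeterSystem M W) {x y : B → ℝ} (hx : x ∈ elementaryRoots cs)
    (hy : y ∈ elementaryRoots cs) (hxy : geoForm M y x = 1) (hd : depth cs x < depth cs y) :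
    False := by
  have heq : x = y := by
    refine hy.2.2 x hx.1 hx.2.1 fun g hg => ?_
    by_contra hgx
    have hgx' := (root_nonneg_or_nonpos cs (geoRep_mem_roots cs g hx.1)).resolve_right hgx
    obtain ⟨q, hq, hl⟩ := exists_length_eq_depth cs hx.1 hx.2.1
    refine false_of_geoForm_le_neg_one cs hy.1 (neg_mem_roots cs hx.1) (p := g) (q := q)
      ?_ ?_ ?_ hg ?_
    · rw [map_neg, hxy]
    · refine (root_nonneg_or_nonpos cs (geoRep_mem_roots cs q hy.1)).resolve_right fun h => ?_
      exact (depth_le cs h).not_gt (hl ▸ hd)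
    · rw [map_neg]
      exact neg_nonneg.2 hq
    · rw [map_neg]
      exact neg_nonpos.2 hgx'
  rw [heq] at hd
  exact hd.false

lemma not_forall_elementaryStep (cs : CoxeterSystem M W) (x : ℕ → B → ℝ) (l : ℕ → B)
    (h : ∀ n, ElementaryStep cs (l n) (x n) (x (n + 1))) : False := by
  obtain ⟨J, hJ⟩ : ∃ J : Set B, J = {i | ∃ᶠ n in Filter.atTop, l n = i} := ⟨_, rfl⟩
  obtain ⟨K, hK⟩ : ∃ K, ∀ n ≥ K, l n ∈ J := by
    have : ∀ i, ∀ᶠ n in Filter.atTop, l n = i → i ∈ J := by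
      intro i
      by_cases hi : i ∈ J
      · exact Filter.Eventually.of_forall fun _ _ => hi
      · rw [hJ, Set.mem_ofPred_eq, Filter.not_frequently] at hi
        exact hi.mono fun n hn hn' => absurd hn' hn
    obtain ⟨K, hK⟩ := Filter.eventually_atTop.1 (Filter.eventually_all.2 this)
    exact ⟨K, fun n hn => hK n hn _ rfl⟩
  have hlow : ∀ d n i, l (n + d) = i → -1 < geoForm M (x n) (simpleRoot i) := by
    intro d
    induction d with
    | zero =>
      rintro n _ rfl
      exact (h n).neg_one_lt
    | succ d ih =>
      intro n i hi
      by_cases hn : l n = i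
      · exact hn ▸ (h n).neg_one_lt
      · exact (ih (n + 1) i (by rwa [add_right_comm, add_assoc])).trans_le ((h n).geoForm_le hn)
  obtain ⟨V, hV⟩ : ∃ V, V = insert 0 (insert 1
    {c | |c| < 1 ∧ ∃ x ∈ roots cs, ∃ y ∈ roots cs, c = geoForm M x y}) := ⟨_, rfl⟩
  have hVfin : V.Finite := hV ▸ ((finite_geoForm_values cs).insert 1).insert 0
  have hmem : ∀ n, ∀ i ∈ J, geoForm M (x n) (simpleRoot i) ∈ V := by
    intro n i hi
    rw [hJ] at hi
    obtain ⟨m, hm, hmi⟩ := Filter.frequently_atTop.1 hi n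
    obtain ⟨d, rfl⟩ := Nat.exists_eq_add_of_le hm
    have h1 := hlow d n i hmi
    rw [hV]
    by_cases hx : x n = simpleRoot i
    · rw [hx, geoForm_simpleRoot_self]
      exact Or.inr (Or.inl rfl)
    · exact Or.inr (Or.inr ⟨abs_lt.2 ⟨h1, geoForm_simpleRoot_lt_one cs (h n).left_mem hx⟩, _,
        (h n).left_mem.1, _, simpleRoot_mem_roots cs i, rfl⟩)
  obtain ⟨a, b, hab, heq⟩ := Set.Finite.exists_lt_map_eq_of_forall_mem
    (f := fun n i => if i ∈ J then geoForm M (x (K + n)) (simpleRoot i) else 0)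
    (t := Set.pi Set.univ fun _ : B => V) (fun n i _ => by
      dsimp only
      split_ifs with hi
      · exact hmem _ i hi
      · exact hV ▸ Or.inl rfl) (Set.Finite.pi fun _ => hVfin)
  have hcoord : ∀ n, ∀ i ∉ J, x (K + n) i = x K i := by
    intro n i hi
    induction n with
    | zero => rfl
    | succ n ih =>
      have hne : i ≠ l (K + n) := fun hil => hi (hil ▸ hK _ (Nat.le_add_right K n))
      rw [← add_assoc, (h (K + n)).eq, geoRep_simple, simpleRefl_apply]
      simpa [simpleRoot, hne] using ih
  have hself : geoForm M (x (K + b) - x (K + a)) (x (K + b) - x (K + a)) = 0 := by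
    rw [linearMap_eq_sum (geoForm M (x (K + b) - x (K + a))) (x (K + b) - x (K + a))]
    refine Finset.sum_eq_zero fun i _ => ?_
    by_cases hi : i ∈ J
    · have h1 := congrFun heq i
      simp only [hi, if_true] at h1
      rw [map_sub, LinearMap.sub_apply, h1, sub_self, smul_zero]
    · rw [Pi.sub_apply, hcoord b i hi, hcoord a i hi, sub_self, zero_smul]
  have hmono : StrictMono fun n => depth cs (x n) := strictMono_nat_of_lt_succ fun n =>
    (h n).depth_lt
  refine eq_of_geoForm_eq_one cs (h (K + a)).left_mem (h (K + b)).left_mem ?_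
    (hmono (Nat.add_lt_add_left hab K))
  simp only [map_sub, LinearMap.sub_apply, geoForm_root_self cs (h _).left_mem.1] at hself
  rw [geoForm_comm M (x (K + a)) (x (K + b))] at hself
  linarith

lemma finite_reflTransGen_of_wellFounded {α ι : Type*} [Finite ι] (r : ι → α → α → Prop)
    (hr : ∀ i x y z, r i x y → r i x z → y = z) (hwf : WellFounded fun y x => ∃ i, r i x y)
    (x : α) : {y | Relation.ReflTransGen (fun a b => ∃ i, r i a b) x y}.Finite := by
  induction x using hwf.induction with
  | _ x ih =>
    have hfin : (⋃ i, {y | ∃ z, r i x z ∧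
        Relation.ReflTransGen (fun a b => ∃ i, r i a b) z y}).Finite := by
      refine Set.finite_iUnion fun i => ?_
      by_cases hz : ∃ z, r i x z
      · obtain ⟨z, hz⟩ := hz
        refine (ih z ⟨i, hz⟩).subset ?_
        rintro y ⟨z', hz', hy⟩
        rwa [hr i x z' z hz' hz] at hy
      · refine Set.finite_empty.subset ?_
        rintro y ⟨z, hz', -⟩
        exact hz ⟨z, hz'⟩
    refine (hfin.insert x).subset fun y hy => ?_
    rcases Relation.ReflTransGen.cases_head hy with rfl | ⟨z, ⟨i, hi⟩, hz⟩
    · exact Or.inl rfl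
    · exact Or.inr (Set.mem_iUnion.2 ⟨i, z, hi, hz⟩)

lemma finite_elementaryRoots (cs : CoxeterSystem M W) : (elementaryRoots cs).Finite := by
  have hwf : WellFounded fun y x => ∃ i, ElementaryStep cs i x y := by
    rw [wellFounded_iff_isEmpty_descending_chain]
    refine ⟨fun ⟨x, hx⟩ => ?_⟩
    choose l hl using hx
    exact not_forall_elementaryStep cs x l hl
  have hfin := Set.finite_iUnion fun j => finite_reflTransGen_of_wellFounded (ElementaryStep cs)
    (fun i x y z hy hz => hy.eq.trans hz.eq.symm) hwf (simpleRoot j)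
  refine hfin.subset fun x hx => ?_
  induction hd : depth cs x using Nat.strong_induction_on generalizing x with
  | _ n ih =>
    by_cases hne : ∀ i, x ≠ simpleRoot i
    · obtain ⟨i, y, hy⟩ := exists_elementaryStep cs hx hne
      obtain ⟨j, hj⟩ := Set.mem_iUnion.1 (ih _ (hd ▸ hy.depth_lt) y hy.left_mem rfl)
      exact Set.mem_iUnion.2 ⟨j, Relation.ReflTransGen.tail hj ⟨i, hy⟩⟩
    · push Not at hne
      obtain ⟨i, rfl⟩ := hne
      exact Set.mem_iUnion.2 ⟨i, Relation.ReflTransGen.refl⟩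

/-! ### Standard parabolic subgroups -/

lemma geoRep_apply_of_mem_closure (cs : CoxeterSystem M W) {T : Set B} {g : W}
    (hg : g ∈ Subgroup.closure (cs.simple '' T)) {j : B} (hj : j ∉ T) (x : B → ℝ) :
    geoRep cs g x j = x j := by
  induction hg using Subgroup.closure_induction generalizing x with
  | mem _ h =>
    obtain ⟨i, hi, rfl⟩ := h
    have hne : j ≠ i := fun h => hj (h ▸ hi)
    simp [geoRep_simple, simpleRefl_apply, simpleRoot, hne]
  | one => simp
  | mul g h _ _ hg hh => rw [geoRep_mul_apply, hg, hh]
  | inv g _ hg => rw [← hg (geoRep cs g⁻¹ x), geoRep_apply_inv_apply]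

lemma mem_of_isRightDescent_of_mem_closure (cs : CoxeterSystem M W) {T : Set B} {g : W}
    (hg : g ∈ Subgroup.closure (cs.simple '' T)) {i : B} (hi : cs.IsRightDescent g i) :
    i ∈ T := by
  by_contra hiT
  have h := (isRightDescent_iff_geoRep_nonpos cs g i).1 hi i
  rw [geoRep_apply_of_mem_closure cs hg hiT] at h
  simp only [simpleRoot, Pi.single_eq_same, Pi.zero_apply] at h
  linarith

lemma mem_of_isReduced_of_mem_closure (cs : CoxeterSystem M W) {T : Set B} {u : List B}
    (hu : cs.IsReduced u) (hT : cs.wordProd u ∈ Subgroup.closure (cs.simple '' T)) :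
    ∀ i ∈ u, i ∈ T := by
  induction u using List.reverseRecOn with
  | nil => simp
  | append_singleton u i ih =>
    have hu' : cs.IsReduced u := by simpa using hu.take u.length
    have hprod : cs.wordProd (u ++ [i]) * cs.simple i = cs.wordProd u := by
      simp [cs.wordProd_append]
    have hi : i ∈ T := by
      refine mem_of_isRightDescent_of_mem_closure cs hT ?_
      rw [CoxeterSystem.IsRightDescent, hprod, hu.eq, hu'.eq]
      simp
    have hT' : cs.wordProd u ∈ Subgroup.closure (cs.simple '' T) :=
      hprod ▸ mul_mem hT (Subgroup.subset_closure ⟨i, hi, rfl⟩)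
    intro j hj
    rcases List.mem_append.1 hj with hj | hj
    · exact ih hu' hT' j hj
    · rw [List.mem_singleton.1 hj]
      exact hi

/-- If `T` consists of right descents of `g` and `p ++ i :: q` is a reduced word in `T`, then
stripping `i :: q` off the end of `g` leaves an element without the right descent `i`. -/
lemma not_isRightDescent_mul_inv (cs : CoxeterSystem M W) {T : Set B} {g : W}
    (hg : ∀ t ∈ T, cs.IsRightDescent g t) {i : B} {q : List B} (hu : cs.IsReduced (i :: q))
    (hT : ∀ j ∈ i :: q, j ∈ T) : ¬ cs.IsRightDescent (g * (cs.wordProd (i :: q))⁻¹) i := by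
  have hq : cs.IsReduced q := by simpa using hu.drop 1
  have hqT : (cs.wordProd q)⁻¹ ∈ Subgroup.closure (cs.simple '' T) := by
    refine inv_mem (Subgroup.list_prod_mem _ fun x hx => ?_)
    obtain ⟨j, hj, rfl⟩ := List.mem_map.1 hx
    exact Subgroup.subset_closure ⟨j, hT j (List.mem_cons_of_mem i hj), rfl⟩
  have hroot := geoRep_mem_roots cs (cs.wordProd q)⁻¹ (simpleRoot_mem_roots cs i)
  have hnonneg : 0 ≤ geoRep cs (cs.wordProd q)⁻¹ (simpleRoot i) := by
    refine geoRep_simpleRoot_nonneg cs _ i ?_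
    rw [cs.isRightDescent_inv_iff, CoxeterSystem.IsLeftDescent, ← cs.wordProd_cons, hu.eq, hq.eq]
    simp
  have hnonpos : geoRep cs g (geoRep cs (cs.wordProd q)⁻¹ (simpleRoot i)) ≤ 0 := by
    rw [linearMap_eq_sum (geoRep cs g) (geoRep cs (cs.wordProd q)⁻¹ (simpleRoot i))]
    refine Finset.sum_nonpos fun j _ => ?_
    by_cases hj : j ∈ T
    · exact smul_nonpos_of_nonneg_of_nonpos (hnonneg j)
        ((isRightDescent_iff_geoRep_nonpos cs g j).1 (hg j hj))
    · have hji : j ≠ i := fun h => hj (h ▸ hT i List.mem_cons_self)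
      rw [geoRep_apply_of_mem_closure cs hqT hj]
      simp [simpleRoot, hji]
  rw [isRightDescent_iff_geoRep_nonpos, cs.wordProd_cons, mul_inv_rev, cs.inv_simple,
    geoRep_mul_apply, geoRep_mul_apply, geoRep_simple_self, map_neg, map_neg, neg_nonpos]
  intro h
  exact root_ne_zero cs (geoRep_mem_roots cs g hroot) (le_antisymm hnonpos h)

lemma wg_mem_descSubgroup (cs : CoxeterSystem M W) (g : W) : wg cs g ∈ descSubgroup cs g := by
  unfold wg
  split_ifs with h
  · exact h.choose_spec.1
  · exact one_mem _

lemma wg_congr (cs : CoxeterSystem M W) {g h : W} (hgh : descentSet cs g = descentSet cs h) :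
    wg cs g = wg cs h := by
  have h_eq : descSubgroup cs g = descSubgroup cs h := by rw [descSubgroup, descSubgroup, hgh]
  unfold wg
  generalize descSubgroup cs g = H at h_eq ⊢
  subst h_eq
  rfl

lemma exists_length_wg_le (cs : CoxeterSystem M W) : ∃ K, ∀ g, cs.length (wg cs g) ≤ K := by
  have hfin : (Set.range fun g => cs.length (wg cs g)).Finite := by
    refine (Set.finite_range fun T : Set.range (descentSet cs) =>
      cs.length (wg cs T.2.choose)).subset ?_
    rintro _ ⟨g, rfl⟩
    refine ⟨⟨_, g, rfl⟩, ?_⟩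
    dsimp only
    generalize_proofs h
    rw [wg_congr cs h.choose_spec]
  obtain ⟨K, hK⟩ := hfin.bddAbove
  exact ⟨K, fun g => hK ⟨g, rfl⟩⟩

/-! ### The standard language -/

lemma elementaryInversions_mul_wordProd_congr (cs : CoxeterSystem M W) (u : List B) {g h : W}
    (hgh : elementaryInversions cs g = elementaryInversions cs h)
    (hu : ∀ p i q, u = p ++ i :: q → ¬ cs.IsRightDescent (g * cs.wordProd p) i) :
    elementaryInversions cs (g * cs.wordProd u) = elementaryInversions cs (h * cs.wordProd u) := by
  induction u generalizing g h with
  | nil => simpa using hgh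
  | cons i u ih =>
    rw [cs.wordProd_cons, ← mul_assoc, ← mul_assoc]
    refine ih (elementaryInversions_mul_simple_congr cs hgh ?_) fun p j q hpq => ?_
    · simpa using hu [] i u rfl
    · rw [mul_assoc, ← cs.wordProd_cons]
      exact hu (i :: p) j q (by rw [hpq, List.cons_append])

/-- The word `u` may follow a word representing `g` as a block of a standard word. -/
structure IsBlock (cs : CoxeterSystem M W) (g : W) (u : List B) : Prop where
  ne_one : g * cs.wordProd u ≠ 1
  length_eq : u.length = cs.length (wg cs (g * cs.wordProd u))
  prod_eq : cs.wordProd u = wg cs (g * cs.wordProd u)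

lemma IsBlock.congr {cs : CoxeterSystem M W} {g h : W} {u : List B} (hu : IsBlock cs g u)
    (hgh : elementaryInversions cs g = elementaryInversions cs h) : IsBlock cs h u ∧
      elementaryInversions cs (g * cs.wordProd u) =
        elementaryInversions cs (h * cs.wordProd u) := by
  have hred : cs.IsReduced u := by
    rw [CoxeterSystem.IsReduced, hu.prod_eq, hu.length_eq]
  have hT : ∀ j ∈ u, j ∈ descentSet cs (g * cs.wordProd u) :=
    mem_of_isReduced_of_mem_closure cs hred
      (hu.prod_eq.symm.subst (motive := fun w => w ∈ descSubgroup cs (g * cs.wordProd u))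
        (wg_mem_descSubgroup cs (g * cs.wordProd u)))
  have heq := elementaryInversions_mul_wordProd_congr cs u hgh (by
    rintro p i q rfl
    have := not_isRightDescent_mul_inv cs (i := i) (q := q) (fun t ht => ht)
      (by simpa using hred.drop p.length) (fun j hj => hT j (List.mem_append_right p hj))
    rwa [cs.wordProd_append, ← mul_assoc, mul_inv_cancel_right] at this)
  have hdesc : descentSet cs (g * cs.wordProd u) = descentSet cs (h * cs.wordProd u) := by
    ext i
    simp only [descentSet, Set.mem_ofPred_eq, isRightDescent_iff_mem_elementaryInversions, heq]
  refine ⟨⟨fun h1 => ?_, ?_, ?_⟩, heq⟩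
  · obtain ⟨i, hi⟩ := cs.exists_rightDescent_of_ne_one hu.ne_one
    have hi' : i ∈ descentSet cs (h * cs.wordProd u) := hdesc ▸ hi
    rw [h1] at hi'
    exact cs.not_isRightDescent_one i hi'
  · rw [← wg_congr cs hdesc]
    exact hu.length_eq
  · rw [← wg_congr cs hdesc]
    exact hu.prod_eq

/-- The words which, starting from `g`, decompose into consecutive blocks. -/
inductive BlockWord (cs : CoxeterSystem M W) : W → List B → Prop
  | nil (g : W) : BlockWord cs g []
  | append {g : W} {u z : List B} (hu : IsBlock cs g u)
      (hz : BlockWord cs (g * cs.wordProd u) z) : BlockWord cs g (u ++ z)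

lemma BlockWord.congr {cs : CoxeterSystem M W} {g : W} {z : List B} (hz : BlockWord cs g z)
    {h : W} (hgh : elementaryInversions cs g = elementaryInversions cs h) :
    BlockWord cs h z := by
  induction hz generalizing h with
  | nil => exact .nil h
  | append hu _ ih => exact .append (hu.congr hgh).1 (ih (hu.congr hgh).2)

lemma BlockWord.trans {cs : CoxeterSystem M W} {g : W} {x y : List B} (hx : BlockWord cs g x)
    (hy : BlockWord cs (g * cs.wordProd x) y) : BlockWord cs g (x ++ y) := by
  induction hx with
  | nil => simpa using hy
  | append hu _ ih =>
    rw [List.append_assoc]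
    rw [cs.wordProd_append, ← mul_assoc] at hy
    exact .append hu (ih hy)

lemma BlockWord.exists_split {cs : CoxeterSystem M W} {K : ℕ}
    (hK : ∀ g, cs.length (wg cs g) ≤ K) {g : W} {z : List B} (hz : BlockWord cs g z) :
    ∀ x y, z = x ++ y → ∃ x' u, x = x' ++ u ∧ u.length ≤ K ∧ BlockWord cs g x' ∧
      BlockWord cs (g * cs.wordProd x') (u ++ y) := by
  induction hz with
  | nil g =>
    intro x y hxy
    obtain ⟨rfl, rfl⟩ := List.append_eq_nil_iff.1 hxy.symm
    exact ⟨[], [], rfl, Nat.zero_le K, .nil g, .nil _⟩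
  | @append g u z hu hz ih =>
    intro x y hxy
    rcases List.append_eq_append_iff.1 hxy with ⟨x₁, rfl, hz'⟩ | ⟨u₁, hu₁, -⟩
    · obtain ⟨x', v, rfl, hv, hx', hvy⟩ := ih x₁ y hz'
      refine ⟨u ++ x', v, (List.append_assoc u x' v).symm, hv, .append hu hx', ?_⟩
      rwa [cs.wordProd_append, ← mul_assoc]
    · refine ⟨[], x, rfl, ?_, .nil g, ?_⟩
      · calc x.length ≤ u.length := by simp [hu₁]
          _ ≤ K := hu.length_eq ▸ hK _
      · rw [cs.wordProd_nil, mul_one, ← hxy]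
        exact .append hu hz

lemma StdLang.append_isBlock {cs : CoxeterSystem M W} {v u : List B} (hv : StdLang cs v)
    (hu : IsBlock cs (cs.wordProd v) u) : StdLang cs (v ++ u) := by
  have hlen : (v ++ u).length - cs.length (wg cs (cs.wordProd (v ++ u))) = v.length := by
    rw [cs.wordProd_append, ← hu.length_eq, List.length_append, Nat.add_sub_cancel]
  refine .step _ ?_ ?_ ?_
  · rw [cs.wordProd_append]
    exact hu.ne_one
  · rwa [hlen, List.take_left]
  · rw [hlen, List.drop_left, cs.wordProd_append]
    exact hu.prod_eq

lemma StdLang.append_blockWord {cs : CoxeterSystem M W} {g : W} {z : List B}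
    (hz : BlockWord cs g z) {v : List B} (hv : StdLang cs v) (hg : cs.wordProd v = g) :
    StdLang cs (v ++ z) := by
  induction hz generalizing v with
  | nil => simpa using hv
  | append hu _ ih =>
    rw [← List.append_assoc]
    exact ih (hv.append_isBlock (hg ▸ hu)) (by rw [cs.wordProd_append, hg])

lemma stdLang_iff_blockWord (cs : CoxeterSystem M W) (v : List B) :
    StdLang cs v ↔ BlockWord cs 1 v := by
  refine ⟨fun hv => ?_, fun hv => StdLang.append_blockWord hv .nil cs.wordProd_nil⟩
  induction hv with
  | nil => exact .nil 1
  | step v hne hpre hsuf ih =>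
    obtain ⟨n, hn⟩ : ∃ n, n = v.length - cs.length (wg cs (cs.wordProd v)) := ⟨_, rfl⟩
    rw [← hn] at ih hsuf
    have hprod : cs.wordProd (v.take n) * cs.wordProd (v.drop n) = cs.wordProd v := by
      rw [← cs.wordProd_append, List.take_append_drop]
    have hu : IsBlock cs (cs.wordProd (v.take n)) (v.drop n) := by
      refine ⟨hprod ▸ hne, ?_, by rw [hprod, hsuf]⟩
      have h1 := cs.length_wordProd_le (v.drop n)
      rw [hsuf] at h1
      rw [hprod]
      rw [List.length_drop] at h1 ⊢
      omega
    have := ih.trans (y := v.drop n ++ []) (.append (by rwa [one_mul]) (.nil _))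
    rwa [List.append_nil, List.take_append_drop] at this

/-- **Theorem.** For every Coxeter group, the standard language is regular. -/
theorem standard_language_regular (cs : CoxeterSystem M W) :
    Language.IsRegular { v : List B | StdLang cs v } := by
  obtain ⟨K, hK⟩ := exists_length_wg_le cs
  refine Language.IsRegular.of_finite_range_leftQuotient ?_
  have hfin : ((elementaryRoots cs).powerset ×ˢ {u : List B | u.length ≤ K}).Finite :=
    (finite_elementaryRoots cs).finite_subsets.prod (List.finite_length_le B K)
  let F : Set (Set (B → ℝ) × List B) → Language B := fun D =>
    {y | ∃ p ∈ D, ∃ g, elementaryInversions cs g = p.1 ∧ BlockWord cs g (p.2 ++ y)}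
  refine (hfin.finite_subsets.image F).subset ?_
  rintro _ ⟨x, rfl⟩
  refine ⟨{p | p.2.length ≤ K ∧ ∃ x', x = x' ++ p.2 ∧ BlockWord cs 1 x' ∧
    p.1 = elementaryInversions cs (cs.wordProd x')}, ?_, ?_⟩
  · rintro p ⟨hp, x', -, -, hx'⟩
    refine ⟨?_, hp⟩
    rw [hx']
    exact fun z hz => hz.1
  · ext y
    change _ ↔ StdLang cs (x ++ y)
    rw [stdLang_iff_blockWord]
    constructor
    · rintro ⟨⟨S, u⟩, ⟨-, x', rfl, hx', rfl⟩, g, hg, hy⟩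
      rw [List.append_assoc]
      refine hx'.trans (hy.congr ?_)
      rwa [one_mul]
    · intro h
      obtain ⟨x', u, rfl, hu, hx', hy⟩ := h.exists_split hK x y rfl
      rw [one_mul] at hy
      exact ⟨(_, u), ⟨hu, x', rfl, hx', rfl⟩, _, rfl, hy⟩

end CoxeterPaper
end

section
/- Let W be a Coxeter group, let g ∈ W, let T ⊆ S be such that ⟨T⟩ is finite, and let w be the longest element of ⟨T⟩. Then T(gw) = T if and only if both of the following hold: (i) T is disjoint from T(g); (ii) for each t ∈ S \ T, the wall dual to the edge (gw, gwt) does not lie in 𝓦(g). -/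
namespace CoxeterPaper

open CoxeterSystem

attribute [local instance] Classical.propDecidable

variable {B : Type} [DecidableEq B] [Fintype B]
variable {W : Type} [Group W] {M : CoxeterMatrix B}

section StrongExchange

omit [DecidableEq B] [Fintype B]

/-! ### The strong exchange condition -/

/-- The action of the simple reflection `i` on pairs of a group element and a sign. -/
noncomputable def signedConj (cs : CoxeterSystem M W) (i : B) : Function.End (W × ZMod 2) :=
  fun p ↦ (cs.simple i * p.1 * cs.simple i, p.2 + if p.1 = cs.simple i then 1 else 0)

theorem prod_map_signedConj (cs : CoxeterSystem M W) (ω : List B) (p : W × ZMod 2) :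
    (ω.map (signedConj cs)).prod p =
      (cs.wordProd ω * p.1 * (cs.wordProd ω)⁻¹, p.2 + (cs.rightInvSeq ω).count p.1) := by
  induction ω with
  | nil => simp [Function.End.one_def]
  | cons i ω ih =>
    rw [List.map_cons, List.prod_cons]
    change signedConj cs i ((ω.map (signedConj cs)).prod p) = _
    rw [ih]
    have h : cs.wordProd ω * p.1 * (cs.wordProd ω)⁻¹ = cs.simple i ↔
        (cs.wordProd ω)⁻¹ * cs.simple i * cs.wordProd ω = p.1 := by
      constructor <;> rintro h
      · rw [← h]; group
      · rw [← h]; group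
    ext
    · simp [signedConj, cs.wordProd_cons, mul_assoc]
    · simp only [signedConj, rightInvSeq, List.count_cons, beq_iff_eq, h]
      split_ifs <;> push_cast <;> ring

theorem even_count_leftInvSeq_alternatingWord (cs : CoxeterSystem M W) (i j : B) (t : W) :
    Even ((cs.leftInvSeq (alternatingWord i j (2 * M i j))).count t) := by
  set l := cs.leftInvSeq (alternatingWord i j (2 * M i j)) with hl
  have hlen : l.length = 2 * M i j := by simp [hl]
  have h : l.drop (M i j) = l.take (M i j) := by
    apply List.ext_getElem
    · simp [hlen]; omega
    · intro k h₁ h₂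
      have hk : k < M i j := by simp [hlen] at h₁; omega
      rw [List.getElem_drop, List.getElem_take]
      simp only [hl]
      rw [cs.getElem_leftInvSeq_alternatingWord i j _ _ (by omega),
        cs.getElem_leftInvSeq_alternatingWord i j _ _ (by omega),
        cs.prod_alternatingWord_eq_mul_pow, cs.prod_alternatingWord_eq_mul_pow,
        show (2 * (M i j + k) + 1) / 2 = M i j + k by omega,
        show (2 * k + 1) / 2 = k by omega, pow_add, cs.simple_mul_simple_pow']
      simp
  rw [← List.take_append_drop (M i j) l, h, List.count_append]
  exact ⟨_, rfl⟩

theorem isLiftable_signedConj (cs : CoxeterSystem M W) : M.IsLiftable (signedConj cs) := by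
  intro i j
  have hpow : ∀ m : ℕ, (signedConj cs i * signedConj cs j) ^ m =
      ((alternatingWord i j (2 * m)).map (signedConj cs)).prod := by
    intro m
    induction m with
    | zero => simp [alternatingWord]
    | succ m ih =>
      rw [pow_succ, ih, show 2 * (m + 1) = 2 * m + 1 + 1 by ring, alternatingWord_succ,
        alternatingWord_succ]
      simp
  have hone : cs.wordProd (alternatingWord i j (2 * M i j)) = 1 := by
    simp [cs.prod_alternatingWord_eq_mul_pow]
  have hcount (t : W) : ((cs.rightInvSeq (alternatingWord i j (2 * M i j))).count t : ZMod 2)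
      = 0 := by
    have hrev : (alternatingWord i j (2 * M i j)).reverse = alternatingWord j i (2 * M j i) := by
      rw [M.symmetric j i]
      generalize M i j = m
      induction m with
      | zero => simp [alternatingWord]
      | succ m ih =>
        rw [show 2 * (m + 1) = 2 * m + 1 + 1 by ring, alternatingWord_succ,
          alternatingWord_succ, alternatingWord_succ', alternatingWord_succ']
        simp [ih]
    rw [← List.count_reverse, ← cs.leftInvSeq_reverse, hrev]
    exact (ZMod.natCast_eq_zero_iff_even).2 (even_count_leftInvSeq_alternatingWord cs j i t)
  rw [hpow]
  funext p
  rw [prod_map_signedConj, hone, hcount]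
  simp [Function.End.one_def]

theorem exists_inversionParity (cs : CoxeterSystem M W) :
    ∃ n : W → W → ZMod 2, ∀ (ω : List B) (t : W),
      n (cs.wordProd ω) t = (cs.leftInvSeq ω).count t := by
  refine ⟨fun w t ↦ (cs.lift ⟨signedConj cs, isLiftable_signedConj cs⟩ w⁻¹ (t, 0)).2,
    fun ω t ↦ ?_⟩
  have h : cs.lift ⟨signedConj cs, isLiftable_signedConj cs⟩ (cs.wordProd ω)⁻¹ =
      (ω.reverse.map (signedConj cs)).prod := by
    rw [← cs.wordProd_reverse, wordProd, map_list_prod, List.map_map]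
    congr 2
    funext i
    exact cs.lift_apply_simple (isLiftable_signedConj cs) i
  simp only [h, prod_map_signedConj, cs.rightInvSeq_reverse, List.count_reverse, zero_add]

/-- The parity of the number of occurrences of `t` in the left inversion sequence of any word
representing `w`. -/
noncomputable def inversionParity (cs : CoxeterSystem M W) : W → W → ZMod 2 :=
  (exists_inversionParity cs).choose

theorem inversionParity_wordProd (cs : CoxeterSystem M W) (ω : List B) (t : W) :
    inversionParity cs (cs.wordProd ω) t = (cs.leftInvSeq ω).count t :=
  (exists_inversionParity cs).choose_spec ω t

theorem leftInvSeq_append (cs : CoxeterSystem M W) (ω ω' : List B) :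
    cs.leftInvSeq (ω ++ ω') =
      cs.leftInvSeq ω ++ (cs.leftInvSeq ω').map (MulAut.conj (cs.wordProd ω)) := by
  induction ω with
  | nil => simp
  | cons i ω ih => simp [leftInvSeq, ih, cs.wordProd_cons]

theorem inversionParity_mul (cs : CoxeterSystem M W) (u v t : W) :
    inversionParity cs (u * v) t =
      inversionParity cs u t + inversionParity cs v (u⁻¹ * t * u) := by
  obtain ⟨ω, rfl⟩ := cs.wordProd_surjective u
  obtain ⟨ω', rfl⟩ := cs.wordProd_surjective v
  rw [← cs.wordProd_append, inversionParity_wordProd, inversionParity_wordProd,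
    inversionParity_wordProd, leftInvSeq_append, List.count_append, Nat.cast_add]
  congr 2
  have h : t = MulAut.conj (cs.wordProd ω) ((cs.wordProd ω)⁻¹ * t * cs.wordProd ω) := by
    simp [mul_assoc]
  conv_lhs => rw [h]
  exact List.count_map_of_injective _ _ (MulAut.conj (cs.wordProd ω)).injective _

theorem inversionParity_self (cs : CoxeterSystem M W) {t : W} (ht : cs.IsReflection t) :
    inversionParity cs t t = 1 := by
  obtain ⟨u, i, rfl⟩ := ht
  have h₁ : inversionParity cs (u * u⁻¹) (u * cs.simple i * u⁻¹) = 0 := by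
    rw [mul_inv_cancel, ← cs.wordProd_nil, inversionParity_wordProd]
    simp
  rw [inversionParity_mul] at h₁
  have h₂ : inversionParity cs (cs.simple i) (cs.simple i) = 1 := by
    have := inversionParity_wordProd cs [i] (cs.simple i)
    simpa using this
  have e₁ : u⁻¹ * (u * cs.simple i * u⁻¹) * u = cs.simple i := by group
  have e₂ : (u * cs.simple i)⁻¹ * (u * cs.simple i * u⁻¹) * (u * cs.simple i) = cs.simple i := by
    simp [mul_assoc]
  rw [e₁] at h₁
  rw [inversionParity_mul, inversionParity_mul, e₁, e₂, h₂, add_right_comm, h₁, zero_add]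

theorem mem_leftInvSeq_of_inversionParity_ne_zero (cs : CoxeterSystem M W) {ω : List B} {t : W}
    (h : inversionParity cs (cs.wordProd ω) t ≠ 0) : t ∈ cs.leftInvSeq ω := by
  rw [inversionParity_wordProd] at h
  by_contra hmem
  exact h (by rw [List.count_eq_zero_of_not_mem hmem, Nat.cast_zero])

theorem isLeftInversion_of_inversionParity_ne_zero (cs : CoxeterSystem M W) {w t : W}
    (h : inversionParity cs w t ≠ 0) : cs.IsLeftInversion w t := by
  obtain ⟨ω, hω, rfl⟩ := cs.exists_isReduced w
  exact cs.isLeftInversion_of_mem_leftInvSeq hω (mem_leftInvSeq_of_inversionParity_ne_zero cs h)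

theorem isLeftInversion_iff_inversionParity (cs : CoxeterSystem M W) {w t : W}
    (ht : cs.IsReflection t) : cs.IsLeftInversion w t ↔ inversionParity cs w t = 1 := by
  refine ⟨fun h ↦ ?_, fun h ↦ isLeftInversion_of_inversionParity_ne_zero cs (by simp [h])⟩
  by_contra hne
  have h₀ : inversionParity cs w t = 0 := by
    generalize inversionParity cs w t = a at hne
    decide +revert
  have h₁ : inversionParity cs (t * w) t = 1 := by
    rw [inversionParity_mul, inversionParity_self cs ht, inv_mul_cancel, one_mul, h₀, add_zero]
  exact ht.isLeftInversion_mul_right_iff.1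
    (isLeftInversion_of_inversionParity_ne_zero cs (by simp [h₁])) h

/-- The strong exchange condition. -/
theorem mem_leftInvSeq_of_isLeftInversion (cs : CoxeterSystem M W) {ω : List B} {t : W}
    (h : cs.IsLeftInversion (cs.wordProd ω) t) : t ∈ cs.leftInvSeq ω :=
  mem_leftInvSeq_of_inversionParity_ne_zero cs
    (by simp [(isLeftInversion_iff_inversionParity cs h.1).1 h])

theorem isLeftInversion_mul (cs : CoxeterSystem M W) {u v t : W} (ht : cs.IsReflection t) :
    cs.IsLeftInversion (u * v) t ↔
      Xor (cs.IsLeftInversion u t) (cs.IsLeftInversion v (u⁻¹ * t * u)) := by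
  have ht' : cs.IsReflection (u⁻¹ * t * u) := by simpa using ht.conj u⁻¹
  rw [isLeftInversion_iff_inversionParity cs ht, isLeftInversion_iff_inversionParity cs ht,
    isLeftInversion_iff_inversionParity cs ht', inversionParity_mul]
  generalize inversionParity cs u t = a
  generalize inversionParity cs v _ = b
  unfold Xor
  decide +revert

theorem isRightInversion_mul (cs : CoxeterSystem M W) {u v t : W} (ht : cs.IsReflection t) :
    cs.IsRightInversion (u * v) t ↔
      Xor (cs.IsRightInversion v t) (cs.IsRightInversion u (v * t * v⁻¹)) := by
  rw [← isLeftInversion_inv_iff, mul_inv_rev, isLeftInversion_mul cs ht,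
    isLeftInversion_inv_iff, isLeftInversion_inv_iff, inv_inv]

end StrongExchange

/-! ### The geometric representation -/

/-- The `i`-th simple coroot of the geometric representation. -/
noncomputable def coroot (M : CoxeterMatrix B) (i : B) : Module.Dual ℝ (B → ℝ) :=
  ∑ j, (-2 * Real.cos (Real.pi / M i j)) • LinearMap.proj j

theorem coroot_single (M : CoxeterMatrix B) (i j : B) :
    coroot M i (Pi.single j 1) = -2 * Real.cos (Real.pi / M i j) := by
  simp [coroot, Pi.single_apply]

theorem coroot_single_self (M : CoxeterMatrix B) (i : B) :
    coroot M i (Pi.single i 1) = 2 := by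
  simp [coroot_single]

/-- The reflection by which the simple generator `i` acts in the geometric representation. -/
noncomputable def geomReflection (M : CoxeterMatrix B) (i : B) : (B → ℝ) ≃ₗ[ℝ] (B → ℝ) :=
  Module.reflection (coroot_single_self M i)

theorem sin_two_pi_div_pos {m : ℕ} (hm : 3 ≤ m) : 0 < Real.sin (2 * Real.pi / m) := by
  have hm' : (3 : ℝ) ≤ m := by exact_mod_cast hm
  apply Real.sin_pos_of_pos_of_lt_pi
  · have := Real.pi_pos
    positivity
  · rw [div_lt_iff₀ (by linarith)]
    nlinarith [Real.pi_pos]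

theorem chebyshevS_eval_eq_zero {m : ℕ} (hm : 3 ≤ m) {a : ℤ} (ha : 2 * (a + 1) = m) :
    (Polynomial.Chebyshev.S ℝ a).eval (2 * Real.cos (2 * Real.pi / m)) = 0 := by
  have hsin := (sin_two_pi_div_pos hm).ne'
  have ha' : (m : ℝ) = 2 * (a + 1) := by exact_mod_cast ha.symm
  have hm' : (m : ℝ) ≠ 0 := by positivity
  have h := Polynomial.Chebyshev.S_two_mul_real_cos (2 * Real.pi / m) a
  have harg : ((a : ℝ) + 1) * (2 * Real.pi / m) = Real.pi := by
    field_simp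
    rw [ha']
    ring
  rw [harg, Real.sin_pi] at h
  exact (mul_eq_zero.1 h).resolve_right hsin

theorem chebyshevS_eval_add_eq_zero {m : ℕ} (hm : 3 ≤ m) {a : ℤ} (ha : 2 * a + 1 = m) :
    (Polynomial.Chebyshev.S ℝ a).eval (2 * Real.cos (2 * Real.pi / m)) +
      (Polynomial.Chebyshev.S ℝ (a - 1)).eval (2 * Real.cos (2 * Real.pi / m)) = 0 := by
  have hsin := (sin_two_pi_div_pos hm).ne'
  have ha' : (m : ℝ) = 2 * a + 1 := by exact_mod_cast ha.symm
  have hm' : (m : ℝ) ≠ 0 := by positivity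
  have h₁ := Polynomial.Chebyshev.S_two_mul_real_cos (2 * Real.pi / m) a
  have h₂ := Polynomial.Chebyshev.S_two_mul_real_cos (2 * Real.pi / m) (a - 1)
  have harg : ((a : ℝ) + 1) * (2 * Real.pi / m) =
      2 * Real.pi - (((a - 1 : ℤ) : ℝ) + 1) * (2 * Real.pi / m) := by
    push_cast
    field_simp
    rw [ha']
    ring
  rw [harg, Real.sin_two_pi_sub] at h₁
  refine (mul_eq_zero.1 ?_).resolve_right hsin
  rw [add_mul, h₁, h₂, neg_add_cancel]

theorem isLiftable_geomReflection (M : CoxeterMatrix B) : M.IsLiftable (geomReflection M) := by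
  intro i j
  rcases eq_or_ne i j with rfl | hij
  · rw [M.diagonal, pow_one]
    ext1 v
    exact Module.involutive_reflection (coroot_single_self M i) v
  obtain h | h | h : M i j = 0 ∨ M i j = 2 ∨ 3 ≤ M i j := by
    have := M.off_diagonal i j hij
    omega
  · rw [h, pow_zero]
  · have hij₀ : coroot M i (Pi.single j 1) = 0 := by simp [coroot_single, h]
    have hji₀ : coroot M j (Pi.single i 1) = 0 := by simp [coroot_single, M.symmetric j i, h]
    rw [h, pow_two]
    ext1 v
    simp only [geomReflection, LinearEquiv.mul_apply, Module.reflection_apply, map_sub, map_smul,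
      hij₀, hji₀, coroot_single_self]
    change _ = v
    module
  · ext1 v
    have ht : 2 * Real.cos (2 * Real.pi / M i j) =
        coroot M i (Pi.single j 1) * coroot M j (Pi.single i 1) - 2 := by
      rw [coroot_single, coroot_single, M.symmetric j i, mul_div_assoc, Real.cos_two_mul]
      ring
    rw [geomReflection, geomReflection,
      Module.reflection_mul_reflection_pow_apply _ _ _ _ _ ht]
    change _ = v
    obtain ⟨k, hk⟩ := Nat.even_or_odd' (M i j)
    rcases hk with hk | hk
    · have h₁ : ((M i j : ℤ) - 2) / 2 = k - 1 := by omega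
      have h₂ : ((M i j : ℤ) - 1) / 2 = k - 1 := by omega
      rw [h₁, h₂, chebyshevS_eval_eq_zero h (a := k - 1) (by omega)]
      simp
    · have h₁ : ((M i j : ℤ) - 2) / 2 = k - 1 := by omega
      have h₂ : ((M i j : ℤ) - 1) / 2 = k := by omega
      have h₃ : ((M i j : ℤ) - 3) / 2 = k - 1 := by omega
      have h₄ : (M i j : ℤ) / 2 = k := by omega
      rw [h₁, h₂, h₃, h₄, chebyshevS_eval_add_eq_zero h (a := k) (by omega)]
      simp

theorem mem_of_simple_mem_closure (cs : CoxeterSystem M W) {T : Set B} {t : B}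
    (h : cs.simple t ∈ Subgroup.closure (cs.simple '' T)) : t ∈ T := by
  by_contra ht
  let φ := cs.lift ⟨geomReflection M, isLiftable_geomReflection M⟩
  have hφ (i : B) : φ (cs.simple i) = geomReflection M i :=
    cs.lift_apply_simple (isLiftable_geomReflection M) i
  have key : ∀ u ∈ Subgroup.closure (cs.simple '' T), ∀ v : B → ℝ, φ u v t = v t := by
    intro u hu
    induction hu using Subgroup.closure_induction with
    | mem x hx =>
      obtain ⟨i, hi, rfl⟩ := hx
      intro v
      have hne : t ≠ i := fun h ↦ ht (h ▸ hi)
      simp [hφ, geomReflection, Module.reflection_apply, hne]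
    | one => simp
    | mul x y _ _ hx hy => intro v; rw [map_mul, LinearEquiv.mul_apply, hx, hy]
    | inv x _ hx =>
      intro v
      rw [← hx (φ x⁻¹ v), ← LinearEquiv.mul_apply, ← map_mul, mul_inv_cancel, map_one]
      rfl
  have := key _ h (Pi.single t 1)
  rw [hφ, geomReflection, Module.reflection_apply_self] at this
  norm_num at this

/-! ### Standard parabolic subgroups -/

section Parabolic

omit [DecidableEq B] [Fintype B]

theorem exists_word_of_mem_closure (cs : CoxeterSystem M W) {T : Set B} {u : W}
    (hu : u ∈ Subgroup.closure (cs.simple '' T)) :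
    ∃ ω : List B, (∀ i ∈ ω, i ∈ T) ∧ cs.wordProd ω = u := by
  induction hu using Subgroup.closure_induction with
  | mem x hx =>
    obtain ⟨i, hi, rfl⟩ := hx
    exact ⟨[i], by simpa using hi, by simp⟩
  | one => exact ⟨[], by simp, by simp⟩
  | mul x y _ _ hx hy =>
    obtain ⟨ω, hω, rfl⟩ := hx
    obtain ⟨ω', hω', rfl⟩ := hy
    exact ⟨ω ++ ω', by grind, cs.wordProd_append ω ω'⟩
  | inv x _ hx =>
    obtain ⟨ω, hω, rfl⟩ := hx
    exact ⟨ω.reverse, by simpa using hω, cs.wordProd_reverse ω⟩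

theorem simple_mem_closure (cs : CoxeterSystem M W) {T : Set B} {i : B} (hi : i ∈ T) :
    cs.simple i ∈ Subgroup.closure (cs.simple '' T) :=
  Subgroup.subset_closure ⟨i, hi, rfl⟩

theorem conj_mem_closure_iff (cs : CoxeterSystem M W) {T : Set B} {u t : W}
    (hu : u ∈ Subgroup.closure (cs.simple '' T)) :
    u * t * u⁻¹ ∈ Subgroup.closure (cs.simple '' T) ↔
      t ∈ Subgroup.closure (cs.simple '' T) := by
  rw [Subgroup.mul_mem_cancel_right _ (inv_mem hu), Subgroup.mul_mem_cancel_left _ hu]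

theorem wordProd_mem_closure (cs : CoxeterSystem M W) {T : Set B} {ω : List B}
    (hω : ∀ i ∈ ω, i ∈ T) : cs.wordProd ω ∈ Subgroup.closure (cs.simple '' T) := by
  refine Subgroup.list_prod_mem _ fun x hx ↦ ?_
  obtain ⟨i, hi, rfl⟩ := List.mem_map.1 hx
  exact simple_mem_closure cs (hω i hi)

theorem mem_closure_of_isLeftInversion (cs : CoxeterSystem M W) {T : Set B} {u t : W}
    (hu : u ∈ Subgroup.closure (cs.simple '' T)) (ht : cs.IsLeftInversion u t) :
    t ∈ Subgroup.closure (cs.simple '' T) := by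
  obtain ⟨ω, hω, rfl⟩ := exists_word_of_mem_closure cs hu
  obtain ⟨j, hj, rfl⟩ := List.mem_iff_getElem.1 (mem_leftInvSeq_of_isLeftInversion cs ht)
  rw [cs.length_leftInvSeq] at hj
  rw [cs.getElem_leftInvSeq ω j hj, conj_mem_closure_iff cs
    (wordProd_mem_closure cs fun i hi ↦ hω i (List.mem_of_mem_take hi))]
  exact simple_mem_closure cs (hω _ (List.getElem_mem hj))

theorem isLeftInversion_conj_iff (cs : CoxeterSystem M W) (g t : W) :
    cs.IsLeftInversion g (g * t * g⁻¹) ↔ cs.IsRightInversion g t := by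
  simp [IsLeftInversion, IsRightInversion]

theorem mem_closure_of_isRightInversion (cs : CoxeterSystem M W) {T : Set B} {u t : W}
    (hu : u ∈ Subgroup.closure (cs.simple '' T)) (ht : cs.IsRightInversion u t) :
    t ∈ Subgroup.closure (cs.simple '' T) :=
  mem_closure_of_isLeftInversion cs (inv_mem hu) (cs.isLeftInversion_inv_iff.2 ht)

end Parabolic

theorem exists_isRightDescent_of_mem_closure (cs : CoxeterSystem M W) {T : Set B} {u : W}
    (hu : u ∈ Subgroup.closure (cs.simple '' T)) (hne : u ≠ 1) :
    ∃ i ∈ T, cs.IsRightDescent u i := by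
  obtain ⟨i, hi⟩ := cs.exists_rightDescent_of_ne_one hne
  exact ⟨i, mem_of_simple_mem_closure cs (mem_closure_of_isRightInversion cs hu
    ((cs.isRightInversion_simple_iff_isRightDescent u i).2 hi)), hi⟩

/-- An element without right descents in `T` has no right inversions in `⟨T⟩`. -/
theorem not_isRightInversion_of_disjoint (cs : CoxeterSystem M W) {T : Set B} {g : W}
    (hg : Disjoint T (descentSet cs g)) {t : W}
    (ht : t ∈ Subgroup.closure (cs.simple '' T)) : ¬ cs.IsRightInversion g t := by
  obtain ⟨v, hv, hmin⟩ := exists_minimalFor_of_wellFoundedLT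
    (· ∈ Subgroup.closure (cs.simple '' T)) (fun v ↦ cs.length (g * v)) ⟨1, one_mem _⟩
  have hm : ∀ r ∈ Subgroup.closure (cs.simple '' T), ¬ cs.IsRightInversion (g * v) r := by
    intro r hr h
    have := h.2
    rw [mul_assoc] at this
    exact this.not_ge (hmin (mul_mem hv hr) this.le)
  obtain rfl | hne := eq_or_ne v 1
  · simpa using hm t ht
  obtain ⟨i, hi, hdesc⟩ := exists_isRightDescent_of_mem_closure cs (inv_mem hv)
    (inv_ne_one.2 hne)
  have hinv := (isRightInversion_mul cs (u := g * v) (v := v⁻¹) (cs.isReflection_simple i)).2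
    (Or.inl ⟨(cs.isRightInversion_simple_iff_isRightDescent _ _).2 hdesc,
      hm _ ((conj_mem_closure_iff cs (inv_mem hv)).2 (simple_mem_closure cs hi))⟩)
  rw [mul_inv_cancel_right, isRightInversion_simple_iff_isRightDescent] at hinv
  exact (Set.disjoint_left.1 hg hi hinv).elim

/-- If `⟨T⟩` is finite, then all reflections of `⟨T⟩` are right inversions of an element whose
right descent set contains `T`. -/
theorem isRightInversion_of_subset_descentSet (cs : CoxeterSystem M W) {T : Set B} {x : W}
    (hfin : (Subgroup.closure (cs.simple '' T) : Set W).Finite)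
    (hx : T ⊆ descentSet cs x) {t : W} (ht : cs.IsReflection t)
    (htT : t ∈ Subgroup.closure (cs.simple '' T)) : cs.IsRightInversion x t := by
  obtain ⟨v, hv, hmax⟩ := Set.exists_max_image _ (fun v ↦ cs.length (x * v)) hfin ⟨1, one_mem _⟩
  have hM : ∀ r ∈ Subgroup.closure (cs.simple '' T), cs.IsReflection r →
      cs.IsRightInversion (x * v) r := by
    intro r hr hrefl
    refine ⟨hrefl, lt_of_le_of_ne ?_ (hrefl.length_mul_left_ne _)⟩
    rw [mul_assoc]
    exact hmax _ (mul_mem hv hr)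
  obtain rfl | hne := eq_or_ne v 1
  · simpa using hM t htT ht
  obtain ⟨i, hi, hdesc⟩ := exists_isRightDescent_of_mem_closure cs (inv_mem hv)
    (inv_ne_one.2 hne)
  have hinv := (cs.isRightInversion_simple_iff_isRightDescent _ _).2 (hx hi)
  rw [← mul_inv_cancel_right x v, isRightInversion_mul cs (cs.isReflection_simple i)] at hinv
  have h₁ := (cs.isRightInversion_simple_iff_isRightDescent _ _).2 hdesc
  have h₂ := hM _ ((conj_mem_closure_iff cs (inv_mem hv)).2 (simple_mem_closure cs hi))
    ((cs.isReflection_simple i).conj _)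
  rcases hinv with h | h
  · exact (h.2 h₂).elim
  · exact (h.2 h₁).elim

omit [DecidableEq B] [Fintype B] in
/-- Every left inversion wall of `g` is adjacent to some `h` on a geodesic from `1` to `g`. -/
theorem exists_adjacentWall_of_isLeftInversion (cs : CoxeterSystem M W) {g t : W}
    (ht : cs.IsLeftInversion g t) :
    ∃ h, AdjacentWall cs t h ∧ cs.length h + cs.length (h⁻¹ * g) = cs.length g := by
  obtain ⟨ω, hω, rfl⟩ := cs.exists_isReduced g
  obtain ⟨j, hj, rfl⟩ := List.mem_iff_getElem.1 (mem_leftInvSeq_of_isLeftInversion cs ht)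
  rw [cs.length_leftInvSeq] at hj
  refine ⟨cs.wordProd (ω.take j), ⟨ω[j], cs.getElem_leftInvSeq ω j hj⟩, ?_⟩
  have h : (cs.wordProd (ω.take j))⁻¹ * cs.wordProd ω = cs.wordProd (ω.drop j) := by
    rw [inv_mul_eq_iff_eq_mul, ← cs.wordProd_append, List.take_append_drop]
  rw [h, (hω.take j).eq, (hω.drop j).eq, hω.eq, ← List.length_append, List.take_append_drop]

omit [DecidableEq B] [Fintype B] in
theorem isLeftInversion_of_length_add_eq (cs : CoxeterSystem M W) {g h t : W}
    (hlen : cs.length h + cs.length (h⁻¹ * g) = cs.length g) (ht : cs.IsLeftInversion h t) :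
    cs.IsLeftInversion g t := by
  refine ⟨ht.1, ?_⟩
  have h₁ := cs.length_mul_le (t * h) (h⁻¹ * g)
  rw [mul_assoc, mul_inv_cancel_left] at h₁
  have := ht.2
  omega

/-- **Lemma.** `T(gw) = T` iff `T` is disjoint from `T(g)` and for each `t ∈ S \ T`
the wall dual to the edge `(gw, gwt)` does not lie in `𝓦(g)`. -/
theorem descent_of_append (cs : CoxeterSystem M W) (g : W) (T : Set B)
    (hfin : (Subgroup.closure (cs.simple '' T) : Set W).Finite)
    (w : W) (hw : w ∈ Subgroup.closure (cs.simple '' T))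
    (hlongest : ∀ u ∈ Subgroup.closure (cs.simple '' T), cs.length u ≤ cs.length w) :
    descentSet cs (g * w) = T ↔
      (Disjoint T (descentSet cs g) ∧
        ∀ t : B, t ∉ T → (g * w) * cs.simple t * (g * w)⁻¹ ∉ WallsNear cs g) := by
  have hwinv : ∀ r ∈ Subgroup.closure (cs.simple '' T), cs.IsReflection r →
      cs.IsRightInversion w r := fun r hr hrefl ↦
    ⟨hrefl, lt_of_le_of_ne (hlongest _ (mul_mem hw hr)) (hrefl.length_mul_left_ne w)⟩
  have hcross : ∀ t ∉ T, (cs.IsLeftInversion g (g * w * cs.simple t * (g * w)⁻¹) ↔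
      cs.IsRightDescent (g * w) t) := by
    intro t ht
    have hnot : ¬ cs.IsLeftInversion w (w * cs.simple t * w⁻¹) := fun h ↦
      ht (mem_of_simple_mem_closure cs ((conj_mem_closure_iff cs hw).1
        (mem_closure_of_isLeftInversion cs hw h)))
    rw [← isRightInversion_simple_iff_isRightDescent, ← isLeftInversion_conj_iff,
      isLeftInversion_mul cs ((cs.isReflection_simple t).conj _)]
    have e : g⁻¹ * (g * w * cs.simple t * (g * w)⁻¹) * g = w * cs.simple t * w⁻¹ := by group
    rw [e]
    simp [Xor, hnot]
  constructor
  · intro h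
    refine ⟨Set.disjoint_left.2 fun i hi hdesc ↦ ?_, fun t ht hwall ↦ ?_⟩
    · have hmem := (conj_mem_closure_iff cs (inv_mem hw)).2 (simple_mem_closure cs hi)
      have hrefl := (cs.isReflection_simple i).conj w⁻¹
      have h₁ := isRightInversion_of_subset_descentSet cs hfin h.ge hrefl hmem
      rw [isRightInversion_mul cs hrefl] at h₁
      have e : w * (w⁻¹ * cs.simple i * w⁻¹⁻¹) * w⁻¹ = cs.simple i := by group
      rw [e, isRightInversion_simple_iff_isRightDescent] at h₁
      rcases h₁ with h₁ | h₁
      · exact h₁.2 hdesc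
      · exact h₁.2 (hwinv _ hmem hrefl)
    · exact ht (h.le ((hcross t ht).1 ⟨hwall.1, hwall.2.1⟩))
  · rintro ⟨hdisj, hwalls⟩
    refine Set.Subset.antisymm (fun t hdesc ↦ ?_) fun i hi ↦ ?_
    · by_contra ht
      have hρ := (hcross t ht).2 hdesc
      refine hwalls t ht ⟨hρ.1, hρ.2, fun ρ' hρ' _ hsep ↦ ?_⟩
      have hg : ¬ cs.IsLeftInversion g ρ' := by
        intro hinv
        have hgw : ¬ cs.IsLeftInversion (g * w) ρ' := by
          rcases hsep (g * w) ⟨t, rfl⟩ with h | h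
          · exact fun h' ↦ h.2 h'.2
          · exact (h.2 hinv.2).elim
        rw [isLeftInversion_mul cs hρ'] at hgw
        have hw' : cs.IsLeftInversion w (g⁻¹ * ρ' * g) := by
          by_contra h
          exact hgw (Or.inl ⟨hinv, h⟩)
        refine not_isRightInversion_of_disjoint cs hdisj
          (mem_closure_of_isLeftInversion cs hw hw') ?_
        rw [← isLeftInversion_conj_iff]
        simpa [mul_assoc] using hinv
      obtain ⟨h, hadj, hlen⟩ := exists_adjacentWall_of_isLeftInversion cs hρ
      rcases hsep h hadj with h' | h'
      · exact hg ⟨hρ', h'.1⟩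
      · exact hg (isLeftInversion_of_length_add_eq cs hlen ⟨hρ', h'.1⟩)
    · refine (cs.isRightInversion_simple_iff_isRightDescent _ _).1 ?_
      rw [isRightInversion_mul cs (cs.isReflection_simple i)]
      exact Or.inl ⟨hwinv _ (simple_mem_closure cs hi) (cs.isReflection_simple i),
        not_isRightInversion_of_disjoint cs hdisj
          ((conj_mem_closure_iff cs hw).2 (simple_mem_closure cs hi))⟩

end CoxeterPaper
end
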